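/- Let c be a two-dimensional configuration over a finite alphabet that has low complexity with respect to a finite non-empty convex set D ⊆ ℤ² (i.e., D = C ∩ ℤ² for some convex C ⊆ ℝ²). Then the orbit closure of c contains a periodic configuration. -/

import Mathlib

/-- Translation of a configuration by `t`: `(Translate t c) n = c (n - t)`. -/
def Translate {A : Type*} (t : ℤ × ℤ) (c : ℤ × ℤ → A) : ℤ × ℤ → A :=
  fun n => c (n - t)

/-- The orbit of a configuration: the set of all its translates. -/
def orbit {A : Type*} (c : ℤ × ℤ → A) : Set (ℤ × ℤ → A) :=
  { d | ∃ t : ℤ × ℤ, d = Translate t c }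

/-- The orbit closure: the topological closure of the orbit (in the product
topology of the discrete topology on the alphabet). -/
def orbitClosure {A : Type*} [TopologicalSpace A] (c : ℤ × ℤ → A) : Set (ℤ × ℤ → A) :=
  closure (orbit c)

/-- The standard inner product on `ℤ²`. -/
def inner2 (x u : ℤ × ℤ) : ℤ := x.1 * u.1 + x.2 * u.2

/-- The discrete half plane in direction `u`. -/
def halfPlane (u : ℤ × ℤ) : Set (ℤ × ℤ) := { x | inner2 x u < 0 }

/-- A set of configurations is deterministic in direction `u`: the contents of a
configuration on the half plane `H_u` determine the whole configuration. -/
def DeterministicIn {A : Type*} (X : Set (ℤ × ℤ → A)) (u : ℤ × ℤ) : Prop :=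
  ∀ d ∈ X, ∀ e ∈ X, Set.EqOn d e (halfPlane u) → d = e

/-- The set of `D`-patterns appearing in `c` : restrictions of translates of `c` to `D`. -/
def patterns {A : Type*} (c : ℤ × ℤ → A) (D : Set (ℤ × ℤ)) : Set (D → A) :=
  { p | ∃ t : ℤ × ℤ, ∀ x : D, p x = Translate t c x }

/-- A configuration is periodic if it is fixed by some non-trivial translation. -/
def Periodic {A : Type*} (c : ℤ × ℤ → A) : Prop :=
  ∃ t : ℤ × ℤ, t ≠ 0 ∧ Translate t c = c

/-- The discrete rectangle `{1,…,n} × {1,…,m}`. -/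
def rect (n m : ℕ) : Set (ℤ × ℤ) :=
  { x | 1 ≤ x.1 ∧ x.1 ≤ (n : ℤ) ∧ 1 ≤ x.2 ∧ x.2 ≤ (m : ℤ) }

/-- A set `D ⊆ ℤ²` is (discretely) convex if it is the set of lattice points of a
convex subset of the real plane. -/
def DiscreteConvex (D : Set (ℤ × ℤ)) : Prop :=
  ∃ C : Set (ℝ × ℝ), Convex ℝ C ∧
    D = (fun x : ℤ × ℤ => ((x.1 : ℝ), (x.2 : ℝ))) ⁻¹' C

section Differences

variable {G E : Type*} [AddCommGroup G] [AddCommGroup E]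

/-- The difference operator in direction `v`. -/
def dif (v : G) : AddMonoid.End (G → E) where
  toFun f := fun p => f (p + v) - f p
  map_zero' := by ext; simp
  map_add' f g := by ext; simp; abel

@[simp] theorem dif_apply (v : G) (f : G → E) (p : G) : dif v f p = f (p + v) - f p := rfl

theorem dif_commute (v w : G) : Commute (dif v : AddMonoid.End (G → E)) (dif w) := by
  ext f p
  simp [add_right_comm p v w]
  abel

/-- The composition of the difference operators in the directions of a list. -/
def difs (l : List G) : AddMonoid.End (G → E) := (l.map dif).prod

@[simp] theorem difs_nil (f : G → E) : difs [] f = f := rfl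

@[simp] theorem difs_cons (v : G) (l : List G) (f : G → E) :
    difs (v :: l) f = dif v (difs l f) := by
  simp [difs]

theorem difs_dif (l : List G) (v : G) (f : G → E) : difs l (dif v f) = dif v (difs l f) := by
  induction l with
  | nil => rfl
  | cons w l ih =>
    rw [difs_cons, difs_cons, ih]
    exact DFunLike.congr_fun (dif_commute w v).eq _

theorem difs_append (l l' : List G) (f : G → E) : difs (l ++ l') f = difs l (difs l' f) := by
  simp [difs]

theorem difs_eq_zero_of_mem {l : List G} {v : G} (hv : v ∈ l) {f : G → E} (hf : dif v f = 0) :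
    difs l f = 0 := by
  obtain ⟨s, t, rfl⟩ := List.append_of_mem hv
  rw [difs_append, difs_cons, ← difs_dif, hf, map_zero, map_zero]

theorem dif_shift (v : G) (f : G → E) (t : G) :
    dif v (fun p => f (p + t)) = fun p => dif v f (p + t) := by
  ext p
  simp [add_right_comm]

theorem difs_shift (l : List G) (f : G → E) (t : G) :
    difs l (fun p => f (p + t)) = fun p => difs l f (p + t) := by
  induction l with
  | nil => rfl
  | cons v l ih => rw [difs_cons, difs_cons, ih, dif_shift]

end Differences

section Frobenius

variable {G : Type*} [AddCommGroup G]

/-- Translation operators as a representation of the group algebra. -/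
def shiftRep (R : Type*) [CommRing R] :
    Multiplicative G →* Module.End R (G → R) where
  toFun g := LinearMap.funLeft R R (fun p => p + g.toAdd)
  map_one' := by ext; simp [LinearMap.funLeft]
  map_mul' g h := by
    ext
    simp [LinearMap.funLeft, add_assoc]

theorem lift_shiftRep_sum {R ι : Type*} [CommRing R] (s : Finset ι) (f : ι → R)
    (g : ι → G) (c : G → R) (n : G) :
    AddMonoidAlgebra.lift R (Module.End R (G → R)) G (shiftRep R)
      (∑ i ∈ s, AddMonoidAlgebra.single (g i) (f i)) c n = ∑ i ∈ s, f i * c (n + g i) := by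
  simp [map_sum, shiftRep, LinearMap.funLeft, LinearMap.sum_apply, Finset.sum_apply]

theorem dvd_sum_mul_apply_add_nsmul {ι : Type*} (s : Finset ι) (f : ι → ℤ) (g : ι → G)
    (c : G → ℤ) {p : ℕ} (hp : p.Prime) (h : ∀ n, ∑ i ∈ s, f i * c (n + g i) = 0) (n : G) :
    (p : ℤ) ∣ ∑ i ∈ s, f i * c (n + p • g i) := by
  have := Fact.mk hp
  have : CharP (AddMonoidAlgebra (ZMod p) G) p :=
    charP_of_injective_algebraMap (algebraMap (ZMod p) (AddMonoidAlgebra (ZMod p) G)).injective p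
  set L := AddMonoidAlgebra.lift (ZMod p) (Module.End (ZMod p) (G → ZMod p)) G (shiftRep (ZMod p))
  set a : AddMonoidAlgebra (ZMod p) G :=
    ∑ i ∈ s, AddMonoidAlgebra.single (g i) (f i : ZMod p) with ha
  have h0 : L a (fun q => (c q : ZMod p)) = 0 := by
    ext n
    rw [ha, lift_shiftRep_sum]
    have := congrArg (Int.cast : ℤ → ZMod p) (h n)
    simpa using this
  have hpow : a ^ p = ∑ i ∈ s, AddMonoidAlgebra.single (p • g i) (f i : ZMod p) := by
    rw [ha, sum_pow_char p]
    refine Finset.sum_congr rfl fun i _ => ?_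
    rw [AddMonoidAlgebra.single_pow, ZMod.pow_card]
  have h1 : L (a ^ p) (fun q => (c q : ZMod p)) n = 0 := by
    obtain ⟨m, rfl⟩ : ∃ m, p = m + 1 := ⟨p - 1, by have := hp.pos; omega⟩
    rw [map_pow, pow_succ, Module.End.mul_apply, h0, map_zero]
    rfl
  rw [hpow, lift_shiftRep_sum] at h1
  rw [← ZMod.intCast_zmod_eq_zero_iff_dvd]
  simpa using h1

theorem sum_mul_apply_add_nsmul_eq_zero {ι : Type*} (s : Finset ι) (f : ι → ℤ) (g : ι → G)
    (c : G → ℤ) (B : ℕ) (hB : ∀ k : ι → G, |∑ i ∈ s, f i * c (k i)| ≤ B)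
    (h : ∀ n, ∑ i ∈ s, f i * c (n + g i) = 0) :
    ∀ k : ℕ, k ≠ 0 → (∀ p, p.Prime → p ∣ k → B < p) →
      ∀ n, ∑ i ∈ s, f i * c (n + k • g i) = 0 := by
  intro k
  induction k using Nat.recOnMul generalizing g with
  | zero => intro h; exact absurd rfl h
  | one => intro _ _ n; simpa using h n
  | prime p hp =>
    intro _ hk n
    have := dvd_sum_mul_apply_add_nsmul s f g c hp h n
    refine Int.eq_zero_of_abs_lt_dvd this ((hB _).trans_lt ?_)
    exact_mod_cast hk p hp dvd_rfl
  | mul a b iha ihb =>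
    intro hab hk n
    have ha := iha g h (left_ne_zero_of_mul hab) fun p hp hpa => hk p hp (hpa.mul_right b)
    have := ihb (fun i => a • g i) ha (right_ne_zero_of_mul hab)
      (fun p hp hpb => hk p hp (hpb.mul_left a)) n
    refine Eq.trans (Finset.sum_congr rfl fun i _ => ?_) this
    rw [mul_comm a b, mul_nsmul']

theorem exists_difs_eq_zero_of_progressions [IsAddTorsionFree G] {r : ℕ} (hr : r ≠ 0)
    (s : Finset G) (x₀ : G) (hx₀ : x₀ ∉ s) (h : G → G → ℤ)
    (hs : ∀ n, ∀ j : ℕ, h x₀ (n + j • r • x₀) + ∑ x ∈ s, h x (n + j • r • x) = 0) :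
    ∃ V : List G, (∀ v ∈ V, v ≠ 0) ∧ difs V (h x₀) = 0 := by
  classical
  induction s using Finset.induction_on generalizing h with
  | empty =>
    refine ⟨[], by simp, ?_⟩
    ext n
    simpa using hs n 0
  | insert w s hw ih =>
    rw [Finset.mem_insert, not_or] at hx₀
    obtain ⟨V, hV, hV0⟩ := ih hx₀.2 (fun x n => h x (n + r • x) - h x (n + r • w)) (by
      intro n j
      have h1 := hs n (j + 1)
      have h2 := hs (n + r • w) j
      rw [Finset.sum_insert hw] at h1 h2
      have e : ∀ x, n + (j + 1) • r • x = n + j • r • x + r • x := fun x => by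
        rw [add_smul, one_smul, add_assoc]
      have e' : ∀ x, n + r • w + j • r • x = n + j • r • x + r • w := fun x => by abel
      simp only [e, e'] at h1 h2
      simp only [Finset.sum_sub_distrib]
      linarith)
    refine ⟨V ++ [r • (x₀ - w)], ?_, ?_⟩
    · intro v hv
      rw [List.mem_append, List.mem_singleton] at hv
      rcases hv with hv | rfl
      · exact hV v hv
      · exact smul_ne_zero hr (sub_ne_zero.2 hx₀.1)
    · have e : (fun n => h x₀ (n + r • x₀) - h x₀ (n + r • w)) =
          fun n => dif (r • (x₀ - w)) (h x₀) (n + r • w) := by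
        ext n
        simp [smul_sub, add_assoc]
      rw [e, difs_shift] at hV0
      rw [difs_append, difs_cons, difs_nil]
      ext n
      simpa using congrFun hV0 (n - r • w)

theorem exists_difs_eq_zero_of_sum_eq_zero [IsAddTorsionFree G] (s : Finset G) (f : G → ℤ)
    (c : G → ℤ) (hc : (Set.range c).Finite) {x₀ : G} (hx₀ : x₀ ∈ s) (hf : f x₀ ≠ 0)
    (h : ∀ n, ∑ x ∈ s, f x * c (n + x) = 0) :
    ∃ V : List G, (∀ v ∈ V, v ≠ 0) ∧ difs V c = 0 := by
  classical
  obtain ⟨M, hM⟩ : ∃ M : ℕ, ∀ p, |c p| ≤ M := by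
    obtain ⟨M, hM⟩ := (hc.image (fun z : ℤ => z.natAbs)).bddAbove
    refine ⟨M, fun p => ?_⟩
    have := hM ⟨c p, ⟨p, rfl⟩, rfl⟩
    rw [Int.abs_eq_natAbs]
    exact_mod_cast this
  set B : ℕ := (∑ x ∈ s, |f x| * M).toNat with hBdef
  have hB : ∀ k : G → G, |∑ i ∈ s, f i * c (k i)| ≤ B := by
    intro k
    refine (Finset.abs_sum_le_sum_abs _ _).trans (le_trans ?_ (Int.self_le_toNat _))
    refine Finset.sum_le_sum fun i _ => ?_
    rw [abs_mul]
    exact mul_le_mul_of_nonneg_left (hM _) (abs_nonneg _)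
  have key := sum_mul_apply_add_nsmul_eq_zero s f id c B hB h
  have hr : B.factorial ≠ 0 := Nat.factorial_ne_zero B
  obtain ⟨V, hV, hV0⟩ := exists_difs_eq_zero_of_progressions hr (s.erase x₀) x₀
    (Finset.notMem_erase _ _) (fun x n => f x * c (n + x)) (by
      intro n j
      rw [Finset.add_sum_erase s (fun x => f x * c (n + j • B.factorial • x + x)) hx₀]
      have := key (1 + j * B.factorial) (by omega) (by
        intro p hp hpk
        by_contra! hle
        have h1 : p ∣ j * B.factorial := (hp.dvd_factorial.2 hle).mul_left j
        have := (Nat.dvd_add_left h1).1 hpk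
        exact hp.one_lt.ne' (Nat.dvd_one.1 this)) n
      rw [← this]
      refine Finset.sum_congr rfl fun x _ => ?_
      congr 2
      simp only [id, add_smul, one_smul, mul_smul]
      abel)
  refine ⟨V, hV, ?_⟩
  have e : (fun n => f x₀ * c (n + x₀)) = f x₀ • fun n => c (n + x₀) := by
    ext n; simp
  simp only [e, map_zsmul, difs_shift] at hV0
  ext n
  have := congrFun hV0 (n - x₀)
  simpa [hf] using this

end Frobenius

section LowComplexity

theorem exists_int_relation {ι κ : Type*} [Fintype ι] [Fintype κ] [Nonempty κ]
    (h : Fintype.card κ ≤ Fintype.card ι) (P : κ → ι → ℤ) :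
    ∃ f : ι → ℤ, f ≠ 0 ∧ ∃ z : ℤ, ∀ k, ∑ i, f i * P k i = z := by
  classical
  obtain ⟨t, ht, hmul, -⟩ := Int.Matrix.exists_ne_zero_int_vec_norm_le
    (Matrix.of fun k (i : Option ι) => i.elim (-1) (P k))
    (by simpa using Nat.lt_succ_of_le h) Fintype.card_pos
  have hk : ∀ k, ∑ i, t (some i) * P k i = t none := by
    intro k
    have := congrFun hmul k
    simp only [Matrix.mulVec, dotProduct, Matrix.of_apply, Fintype.sum_option, Option.elim,
      Pi.zero_apply] at this
    simp only [mul_comm (t _)]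
    linarith
  refine ⟨fun i => t (some i), fun h0 => ht ?_, t none, hk⟩
  ext i
  cases i with
  | none =>
    obtain ⟨k⟩ := ‹Nonempty κ›
    rw [← hk k]
    exact Finset.sum_eq_zero fun i _ => by rw [congrFun h0 i]; simp
  | some i => exact congrFun h0 i

theorem exists_difs_eq_zero_of_low_complexity {A : Type*} [Finite A] (φ : A → ℤ)
    (c : ℤ × ℤ → A) (D : Set (ℤ × ℤ)) (hfin : D.Finite)
    (hlc : (patterns c D).ncard ≤ D.ncard) :
    ∃ V : List (ℤ × ℤ), (∀ v ∈ V, v ≠ 0) ∧ difs V (φ ∘ c) = 0 := by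
  classical
  have := hfin.fintype
  have : Finite (patterns c D) := Subtype.finite
  have := Fintype.ofFinite (patterns c D)
  have : Nonempty (patterns c D) := ⟨⟨fun x => c x, 0, fun x => by simp [Translate]⟩⟩
  obtain ⟨f, hf, z, hz⟩ := exists_int_relation (ι := D) (κ := patterns c D)
    (by rwa [← Nat.card_eq_fintype_card, ← Nat.card_eq_fintype_card])
    (fun p x => φ (p.1 x))
  obtain ⟨x₀, hx₀⟩ := Function.ne_iff.1 hf
  set F : ℤ × ℤ → ℤ := fun x => if h : x ∈ D then f ⟨x, h⟩ else 0 with hF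
  have hsum : ∀ n, ∑ x ∈ D.toFinset, F x * φ (c (n + x)) = z := by
    intro n
    rw [← hz ⟨fun x => c (n + x), -n, fun x => by
      rw [Translate, sub_neg_eq_add, add_comm]⟩, ← Finset.sum_coe_sort]
    refine Fintype.sum_equiv (Equiv.subtypeEquivRight fun x => Set.mem_toFinset) _ _ fun x => ?_
    have := Set.mem_toFinset.1 x.2
    simp only [hF, this, dite_true]
    rfl
  have hrange : (Set.range (dif (1, 0) (φ ∘ c))).Finite := by
    refine (Set.finite_range fun a : A × A => φ a.1 - φ a.2).subset ?_
    rintro _ ⟨p, rfl⟩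
    exact ⟨(c (p + (1, 0)), c p), rfl⟩
  obtain ⟨V, hV, hV0⟩ := exists_difs_eq_zero_of_sum_eq_zero D.toFinset F (dif (1, 0) (φ ∘ c))
    hrange (x₀ := x₀.1) (by simp) (by simpa [hF] using hx₀) (by
      intro n
      have h1 := hsum (n + (1, 0))
      have h2 := hsum n
      simp only [dif_apply, Function.comp, mul_sub, Finset.sum_sub_distrib, h2,
        add_right_comm n _ ((1, 0) : ℤ × ℤ)] at h1 ⊢
      rw [h1, sub_self])
  refine ⟨(1, 0) :: V, ?_, ?_⟩
  · intro v hv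
    rcases List.mem_cons.1 hv with rfl | hv
    · simp
    · exact hV v hv
  · rw [difs_cons, ← difs_dif, hV0]

end LowComplexity

section Decomposition

open Filter Topology

variable {G : Type*} [AddCommGroup G]

theorem continuous_difs {E : Type*} [AddCommGroup E] [TopologicalSpace E]
    [IsTopologicalAddGroup E] (l : List G) :
    Continuous (difs l : (G → E) → (G → E)) := by
  induction l with
  | nil => exact continuous_id
  | cons v l ih =>
    refine continuous_pi fun p => ?_
    simp only [difs_cons, dif_apply]
    fun_prop

theorem difs_smul {R E : Type*} [AddCommGroup E] [Ring R] [Module R E] (l : List G) (r : R)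
    (f : G → E) : difs l (r • f) = r • difs l f := by
  induction l with
  | nil => rfl
  | cons v l ih =>
    rw [difs_cons, ih, difs_cons]
    ext p
    simp [smul_sub]

theorem apply_add_nsmul_of_dif_eq_zero {E : Type*} [AddCommGroup E] {v : G} {f : G → E}
    (hf : dif v f = 0) (p : G) (k : ℕ) : f (p + k • v) = f p := by
  induction k with
  | zero => simp
  | succ k ih =>
    rw [succ_nsmul, ← add_assoc, ← ih]
    exact sub_eq_zero.1 (congrFun hf _)

theorem apply_add_zsmul_of_dif_eq_zero {E : Type*} [AddCommGroup E] {v : G} {f : G → E}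
    (hf : dif v f = 0) (p : G) (k : ℤ) : f (p + k • v) = f p := by
  obtain ⟨n, rfl | rfl⟩ := k.eq_nat_or_neg
  · simpa using apply_add_nsmul_of_dif_eq_zero hf p n
  · have := apply_add_nsmul_of_dif_eq_zero hf (p + (-n : ℤ) • v) n
    simpa using this.symm

theorem exists_periodic_average (f : G → ℝ) {B : ℝ} (hB : ∀ p, |f p| ≤ B) (v : G) (V : List G)
    (hf : difs (v :: V) f = 0) :
    ∃ g : G → ℝ, (∀ p, |g p| ≤ B) ∧ dif v g = 0 ∧ difs V (f - g) = 0 := by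
  set avg : ℕ → G → ℝ := fun N =>
    ((N : ℝ) + 1)⁻¹ • ∑ k ∈ Finset.range (N + 1), fun p => f (p + k • v) with havg
  have havg' : ∀ N p, avg N p = ((N : ℝ) + 1)⁻¹ * ∑ k ∈ Finset.range (N + 1), f (p + k • v) := by
    intro N p
    simp [havg]
  have hbd : ∀ N p, |avg N p| ≤ B := by
    intro N p
    have hN : (0 : ℝ) < N + 1 := by positivity
    rw [havg', abs_mul, abs_of_pos (inv_pos.2 hN), inv_mul_le_iff₀ hN]
    refine (Finset.abs_sum_le_sum_abs _ _).trans ((Finset.sum_le_card_nsmul _ _ B ?_).trans ?_)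
    · exact fun k _ => hB _
    · simp
  have hlim : ∀ p, ∃ L : ℝ, |L| ≤ B ∧ Tendsto (fun N => avg N p) (hyperfilter ℕ) (𝓝 L) := by
    intro p
    obtain ⟨L, hL, h⟩ := (isCompact_Icc (a := -B) (b := B)).ultrafilter_le_nhds
      ((hyperfilter ℕ).map fun N => avg N p) (by
        rw [le_principal_iff]
        exact mem_map.2 (mem_of_superset univ_mem fun N _ => abs_le.1 (hbd N p)))
    exact ⟨L, abs_le.2 hL, h⟩
  choose g hg hlim using hlim
  have hle : (hyperfilter ℕ : Filter ℕ) ≤ atTop := Nat.hyperfilter_le_atTop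
  refine ⟨g, hg, ?_, ?_⟩
  · ext p
    rw [dif_apply]
    refine tendsto_nhds_unique ((hlim (p + v)).sub (hlim p)) (Tendsto.mono_left ?_ hle)
    have : ∀ N : ℕ, avg N (p + v) - avg N p = ((N : ℝ) + 1)⁻¹ * (f (p + (N + 1) • v) - f p) := by
      intro N
      rw [havg', havg', ← mul_sub, ← Finset.sum_sub_distrib]
      have e : ∀ k : ℕ, p + v + k • v = p + (k + 1) • v := fun k => by
        rw [add_smul, one_smul]; abel
      simp only [e]
      rw [Finset.sum_range_sub (fun k => f (p + k • v))]
      simp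
    simp only [this]
    refine squeeze_zero_norm (a := fun N : ℕ => ((N : ℝ) + 1)⁻¹ * (2 * B)) ?_ ?_
    · intro N
      have hN : (0 : ℝ) < N + 1 := by positivity
      rw [norm_mul, Real.norm_of_nonneg (inv_pos.2 hN).le]
      refine mul_le_mul_of_nonneg_left ?_ (inv_pos.2 hN).le
      refine (abs_sub _ _).trans ?_
      linarith [hB (p + (N + 1) • v), hB p]
    · have := (tendsto_one_div_add_atTop_nhds_zero_nat (𝕜 := ℝ)).mul_const (2 * B)
      simpa using this
  · have h1 : ∀ N, difs V (avg N) = difs V f := by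
      intro N
      have hper : dif v (difs V f) = 0 := by rw [← difs_cons, hf]
      rw [havg]
      simp only [difs_smul, map_sum, difs_shift]
      ext p
      simp only [Pi.smul_apply, Finset.sum_apply, apply_add_nsmul_of_dif_eq_zero hper]
      have hN : (N : ℝ) + 1 ≠ 0 := by positivity
      simp [hN]
    have h2 : Tendsto avg (hyperfilter ℕ) (𝓝 g) := tendsto_pi_nhds.2 hlim
    have h3 := ((continuous_difs V).tendsto g).comp h2
    have h4 : difs V f = difs V g :=
      tendsto_nhds_unique (Tendsto.congr (fun N => (h1 N).symm) tendsto_const_nhds) h3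
    rw [map_sub, h4, sub_self]

theorem exists_sum_periodic (V : List G) (f : G → ℝ) {B : ℝ} (hB : ∀ p, |f p| ≤ B)
    (hf : difs V f = 0) :
    ∃ g : Fin V.length → G → ℝ, (∀ i, ∃ B, ∀ p, |g i p| ≤ B) ∧ (∀ i, dif (V.get i) (g i) = 0) ∧
      f = ∑ i, g i := by
  induction V generalizing f B with
  | nil => exact ⟨fun _ => 0, by simp, by simp, by simpa using hf⟩
  | cons v V ih =>
    obtain ⟨g₀, hg₀, hv, hV⟩ := exists_periodic_average f hB v V hf
    obtain ⟨g, hgB, hgV, hg⟩ := ih (f - g₀) (B := B + B)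
      (fun p => (abs_sub _ _).trans (add_le_add (hB p) (hg₀ p))) hV
    refine ⟨Fin.cons g₀ g, ?_, ?_, ?_⟩
    · intro i
      refine Fin.cases ⟨B, hg₀⟩ (fun i => ?_) i
      simpa using hgB i
    · intro i
      refine Fin.cases (by simpa using hv) (fun i => ?_) i
      simpa using hgV i
    · rw [← sub_add_cancel f g₀, hg]
      simp [Fin.sum_univ_succ, add_comm]

end Decomposition

section Shift

open Filter Topology

variable {G E : Type*} [AddCommGroup G]

/-- The translate of a function by `-t`. -/
def sh (t : G) (f : G → E) : G → E := fun p => f (p + t)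

@[simp] theorem sh_apply (t : G) (f : G → E) (p : G) : sh t f p = f (p + t) := rfl

theorem sh_sh (s t : G) (f : G → E) : sh s (sh t f) = sh (s + t) f := by
  ext p
  simp [add_assoc]

@[simp] theorem sh_zero (f : G → E) : sh 0 f = f := by
  ext p
  simp

theorem continuous_sh [TopologicalSpace E] (t : G) : Continuous (sh t : (G → E) → G → E) :=
  continuous_pi fun p => continuous_apply (p + t)

theorem difs_sh [AddCommGroup E] (l : List G) (t : G) (f : G → E) :
    difs l (sh t f) = sh t (difs l f) :=
  difs_shift l f t

theorem sh_nsmul_mem {Z : Set (G → E)} {s : G} (h : ∀ z ∈ Z, sh s z ∈ Z) (n : ℕ) {z : G → E}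
    (hz : z ∈ Z) : sh (n • s) z ∈ Z := by
  induction n with
  | zero => simpa using hz
  | succ n ih =>
    rw [succ_nsmul', ← sh_sh]
    exact h _ ih

end Shift

section BoundedSequences

theorem eq_of_bounded_of_second_difference {x : ℕ → ℝ} {B : ℝ} (hB : ∀ n, |x n| ≤ B)
    (h : ∀ n, x (n + 2) - x (n + 1) = x (n + 1) - x n) (n : ℕ) : x (n + 1) = x n := by
  have h1 : ∀ n, x (n + 1) - x n = x 1 - x 0 := by
    intro n
    induction n with
    | zero => simp
    | succ n ih => rw [h, ih]
  have h2 : ∀ n : ℕ, x n = x 0 + n * (x 1 - x 0) := by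
    intro n
    induction n with
    | zero => simp
    | succ n ih => push_cast; linarith [h1 n]
  have h3 : x 1 - x 0 = 0 := by
    by_contra hne
    have hpos : 0 < |x 1 - x 0| := abs_pos.2 hne
    obtain ⟨N, hN⟩ := exists_nat_gt (2 * B / |x 1 - x 0|)
    rw [div_lt_iff₀ hpos] at hN
    have h4 : |x N - x 0| = N * |x 1 - x 0| := by
      rw [h2 N, add_sub_cancel_left, abs_mul, Nat.abs_cast]
    have := abs_sub (x N) (x 0)
    linarith [hB N, hB 0]
  linarith [h1 n]

variable {G : Type*} [AddCommGroup G]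

theorem abs_dif_le {f : G → ℝ} {B : ℝ} (hB : ∀ p, |f p| ≤ B) (s p : G) :
    |dif s f p| ≤ 2 * B := by
  rw [dif_apply]
  linarith [abs_sub (f (p + s)) (f p), hB (p + s), hB p]

theorem dif_eq_zero_of_difs_replicate {s : G} {P : Set G} (hP : ∀ p ∈ P, p + s ∈ P) (r : ℕ)
    {f : G → ℝ} {B : ℝ} (hB : ∀ p, |f p| ≤ B)
    (h : ∀ p ∈ P, difs (List.replicate r s) f p = 0) : ∀ p ∈ P, dif s f p = 0 := by
  induction r generalizing f B with
  | zero =>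
    intro p hp
    rw [dif_apply]
    have h1 := h _ hp
    have h2 := h _ (hP p hp)
    simp only [List.replicate_zero, difs_nil] at h1 h2
    rw [h1, h2, sub_zero]
  | succ r ih =>
    have h1 : ∀ p ∈ P, dif s (dif s f) p = 0 := by
      refine ih (f := dif s f) (abs_dif_le hB s) ?_
      simpa only [List.replicate_succ, difs_cons, difs_dif] using h
    intro p hp
    have hPn : ∀ n : ℕ, p + n • s ∈ P := by
      intro n
      induction n with
      | zero => simpa using hp
      | succ n ih => rw [succ_nsmul, ← add_assoc]; exact hP _ ih
    have := eq_of_bounded_of_second_difference (x := fun n => f (p + n • s)) (fun n => hB _)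
      (fun n => by
        have := h1 _ (hPn n)
        simp only [dif_apply] at this
        have e1 : p + (n + 1) • s = p + n • s + s := by rw [succ_nsmul, add_assoc]
        have e2 : p + (n + 2) • s = p + n • s + s + s := by
          rw [add_nsmul, two_nsmul]; abel
        rw [e1, e2]
        linarith) 0
    simp only [zero_add, one_smul, zero_smul, add_zero] at this
    rw [dif_apply, this, sub_self]

theorem difs_replicate_neg {E : Type*} [AddCommGroup E] (s : G) (r : ℕ) (f : G → E) (p : G) :
    difs (List.replicate r (-s)) f p = (-1) ^ r • difs (List.replicate r s) f (p - r • s) := by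
  induction r generalizing p with
  | zero => simp
  | succ r ih =>
    simp only [List.replicate_succ, difs_cons, dif_apply, ih]
    have e1 : p + -s - r • s = p - (r + 1) • s := by rw [succ_nsmul]; abel
    have e2 : p - r • s = p - (r + 1) • s + s := by rw [succ_nsmul]; abel
    rw [e1, e2, pow_succ, ← smul_sub, mul_smul]
    congr 1
    simp

end BoundedSequences

section MinimalSets

open Filter Topology

variable {G : Type*} [AddCommGroup G]

/-- `Z` is a minimal nonempty compact set of real functions invariant under translation. -/
structure IsMinimalFor (s : G) (Z : Set (G → ℝ)) : Prop where
  isCompact : IsCompact Z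
  nonempty : Z.Nonempty
  sh_mem : ∀ z ∈ Z, sh s z ∈ Z
  eq_of_subset : ∀ Z' ⊆ Z, IsClosed Z' → Z'.Nonempty → (∀ z ∈ Z', sh s z ∈ Z') → Z' = Z

theorem exists_isMinimalFor {s : G} {Y : Set (G → ℝ)} (hY : IsCompact Y) (hne : Y.Nonempty)
    (hs : ∀ y ∈ Y, sh s y ∈ Y) : ∃ Z ⊆ Y, IsMinimalFor s Z := by
  obtain ⟨Z, hZY, hZ⟩ := zorn_superset_nonempty
    {Z : Set (G → ℝ) | Z ⊆ Y ∧ IsClosed Z ∧ Z.Nonempty ∧ ∀ z ∈ Z, sh s z ∈ Z} (by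
      intro C hC hchain hCne
      refine ⟨⋂₀ C, ⟨?_, isClosed_sInter fun t ht => (hC ht).2.1, ?_, ?_⟩,
        fun t ht => Set.sInter_subset_of_mem ht⟩
      · obtain ⟨t, ht⟩ := hCne
        exact (Set.sInter_subset_of_mem ht).trans (hC ht).1
      · have := hCne.to_subtype
        refine IsCompact.nonempty_sInter_of_directed_nonempty_isCompact_isClosed
          (IsChain.directedOn hchain.symm) (fun t ht => (hC ht).2.2.1)
          (fun t ht => hY.of_isClosed_subset (hC ht).2.1 (hC ht).1) fun t ht => (hC ht).2.1
      · intro z hz t ht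
        exact (hC ht).2.2.2 z (hz t ht)) Y ⟨le_rfl, hY.isClosed, hne, hs⟩
  refine ⟨Z, hZY, hY.of_isClosed_subset hZ.prop.2.1 hZY, hZ.prop.2.2.1, hZ.prop.2.2.2, ?_⟩
  intro Z' hZ' hc hn hi
  exact hZ'.antisymm (hZ.le_of_le ⟨hZ'.trans hZY, hc, hn, hi⟩ hZ')

namespace IsMinimalFor

variable {s : G} {Z : Set (G → ℝ)}

theorem sh_neg_mem (hZ : IsMinimalFor s Z) : ∀ z ∈ Z, sh (-s) z ∈ Z := by
  have h := hZ.eq_of_subset (sh s '' Z) (by rintro _ ⟨z, hz, rfl⟩; exact hZ.sh_mem z hz)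
    (hZ.isCompact.image (continuous_sh s)).isClosed (hZ.nonempty.image _)
    (by rintro _ ⟨z, hz, rfl⟩; exact ⟨sh s z, hZ.sh_mem z hz, rfl⟩)
  intro z hz
  rw [← h] at hz
  obtain ⟨y, hy, rfl⟩ := hz
  simpa [sh_sh] using hy

theorem recurrent (hZ : IsMinimalFor s Z) {a : G → ℝ} (ha : a ∈ Z) {U : Set (G → ℝ)}
    (hU : U ∈ 𝓝 a) (k₀ : ℕ) : ∃ k ≥ k₀, sh (k • s) a ∈ U := by
  set T : Set (G → ℝ) := {y | ∃ k ≥ k₀, y = sh (k • s) a} with hT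
  have h := hZ.eq_of_subset (closure T)
    (closure_minimal (by rintro _ ⟨k, -, rfl⟩; exact sh_nsmul_mem hZ.sh_mem k ha)
      hZ.isCompact.isClosed) isClosed_closure ⟨_, subset_closure ⟨k₀, le_rfl, rfl⟩⟩ (by
      intro z hz
      refine map_mem_closure (continuous_sh s) hz ?_
      rintro _ ⟨k, hk, rfl⟩
      exact ⟨k + 1, by omega, by rw [sh_sh, succ_nsmul']⟩)
  rw [← h] at ha
  obtain ⟨_, hy, k, hk, rfl⟩ := mem_closure_iff_nhds.1 ha U hU
  exact ⟨k, hk, hy⟩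

theorem eq_of_dif_sub_eq_zero (hZ : IsMinimalFor s Z) {x y : G → ℝ} (hx : x ∈ Z) (hy : y ∈ Z)
    (h : dif s (y - x) = 0) : y = x := by
  set κ := y - x with hκ
  have hcont : Continuous fun z : G → ℝ => z + κ := continuous_id.add continuous_const
  have hmin := hZ.eq_of_subset (Z ∩ (fun z => z + κ) ⁻¹' Z) Set.inter_subset_left
    (hZ.isCompact.isClosed.inter (hZ.isCompact.isClosed.preimage hcont))
    ⟨x, hx, by simpa [hκ] using hy⟩ (by
      rintro z ⟨hz, hz'⟩
      refine ⟨hZ.sh_mem z hz, ?_⟩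
      have e : sh s z + κ = sh s (z + κ) := by
        ext p
        have := congrFun h p
        simp only [dif_apply, Pi.zero_apply] at this
        simp only [Pi.add_apply, sh_apply]
        linarith
      simp only [Set.mem_preimage] at hz' ⊢
      rw [e]
      exact hZ.sh_mem _ hz')
  have hmem : ∀ n : ℕ, x + n • κ ∈ Z := by
    intro n
    induction n with
    | zero => simpa using hx
    | succ n ih =>
      rw [← hmin] at ih
      rw [succ_nsmul, ← add_assoc]
      exact ih.2
  rw [← sub_eq_zero, ← hκ]
  ext p
  obtain ⟨B, hB⟩ := (hZ.isCompact.image (continuous_apply p)).isBounded.exists_norm_le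
  by_contra hne
  have hpos : 0 < |κ p| := abs_pos.2 hne
  obtain ⟨N, hN⟩ := exists_nat_gt (2 * B / |κ p|)
  rw [div_lt_iff₀ hpos] at hN
  have h1 := hB _ ⟨_, hmem N, rfl⟩
  have h2 := hB _ ⟨_, hx, rfl⟩
  have h3 := abs_sub ((x + N • κ) p) (x p)
  have h4 : |(x + N • κ) p - x p| = N * |κ p| := by
    simp [abs_mul]
  simp only [Real.norm_eq_abs] at h1 h2
  linarith

theorem exists_tendsto (hZ : IsMinimalFor s Z) {σ : G} (hσ : ∀ z ∈ Z, sh σ z ∈ Z) {x : G → ℝ}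
    (hx : x ∈ Z) :
    ∃ z ∈ Z, ∀ p, Tendsto (fun n : ℕ => x (p + n • σ)) (hyperfilter ℕ) (𝓝 (z p)) := by
  obtain ⟨z, hz, h⟩ := hZ.isCompact.ultrafilter_le_nhds
    ((hyperfilter ℕ).map fun n => sh (n • σ) x) (by
      rw [le_principal_iff]
      exact mem_map.2 (mem_of_superset univ_mem fun n _ => sh_nsmul_mem hσ n hx))
  exact ⟨z, hz, fun p => tendsto_pi_nhds.1 h p⟩

theorem eqOn_of_dif_sub_eq_zero (hZ : IsMinimalFor s Z) {σ : G} (hσ : σ = s ∨ σ = -s)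
    {P : Set G} (hP : ∀ p ∈ P, p + σ ∈ P) (habs : ∀ p, ∃ n : ℕ, p + n • σ ∈ P)
    {x y : G → ℝ} (hx : x ∈ Z) (hy : y ∈ Z) (h : ∀ p ∈ P, dif σ (y - x) p = 0) :
    ∀ p ∈ P, y p = x p := by
  have hinv : ∀ z ∈ Z, sh σ z ∈ Z := by
    rcases hσ with rfl | rfl
    exacts [hZ.sh_mem, hZ.sh_neg_mem]
  obtain ⟨x', hx', hxl⟩ := hZ.exists_tendsto hinv hx
  obtain ⟨y', hy', hyl⟩ := hZ.exists_tendsto hinv hy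
  have hPn : ∀ p ∈ P, ∀ n : ℕ, p + n • σ ∈ P := by
    intro p hp n
    induction n with
    | zero => simpa using hp
    | succ n ih => rw [succ_nsmul, ← add_assoc]; exact hP _ ih
  have hle : (hyperfilter ℕ : Filter ℕ) ≤ atTop := Nat.hyperfilter_le_atTop
  have hdif : dif σ (y' - x') = 0 := by
    ext p
    have h1 := ((hyl (p + σ)).sub (hxl (p + σ))).sub ((hyl p).sub (hxl p))
    refine tendsto_nhds_unique h1 (tendsto_const_nhds.congr' (hle ?_))
    obtain ⟨N, hN⟩ := habs p
    filter_upwards [eventually_ge_atTop N] with n hn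
    obtain ⟨m, rfl⟩ := Nat.exists_eq_add_of_le hn
    have := h _ (hPn _ hN m)
    rw [add_assoc, ← add_nsmul, dif_apply] at this
    refine this.symm.trans ?_
    simp only [Pi.sub_apply, add_right_comm p σ]
  have hdif' : dif s (y' - x') = 0 := by
    rcases hσ with rfl | rfl
    · exact hdif
    · ext p
      have := congrFun hdif (p + s)
      simp only [dif_apply, add_neg_cancel_right, Pi.zero_apply] at this ⊢
      linarith
  have heq := hZ.eq_of_dif_sub_eq_zero hx' hy' hdif'
  intro p hp
  rw [← sub_eq_zero, ← sub_self (x' p)]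
  nth_rewrite 1 [← heq]
  refine tendsto_nhds_unique (tendsto_const_nhds.congr fun n => ?_) ((hyl p).sub (hxl p))
  have : ∀ n : ℕ, (y - x) (p + n • σ) = (y - x) p := by
    intro n
    induction n with
    | zero => simp
    | succ n ih =>
      rw [← ih, succ_nsmul, ← add_assoc]
      exact sub_eq_zero.1 (h _ (hPn p hp n))
  exact (this n).symm

end IsMinimalFor

end MinimalSets

section Asymptotic

open Filter Topology

variable {G : Type*} [AddCommGroup G]

theorem exists_periodic_or_asymptotic (η : G →+ ℤ) {s v : G} (hs : 0 < η s)
    (hrep : ∀ l h : ℤ, ∃ F : Finset G, ∀ p, l < η p → η p ≤ h → ∃ f ∈ F, ∃ i : ℤ, p = f + i • v)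
    {Y : Set (G → ℝ)} (hY : IsCompact Y) (hne : Y.Nonempty) (hinv : ∀ y ∈ Y, sh s y ∈ Y)
    {B : ℝ} (hB : ∀ y ∈ Y, ∀ p, |y p| ≤ B) (hper : ∀ y ∈ Y, dif v y = 0) (r : ℕ)
    (hint : ∀ y ∈ Y, ∀ p, ∃ z : ℤ, difs (List.replicate r s) y p = z) :
    (∃ a ∈ Y, ∃ k : ℕ, 1 ≤ k ∧ sh (k • s) a = a) ∨
    ∃ a ∈ Y, ∃ b ∈ Y, (∀ p, 0 < η p → a p = b p) ∧
      (∃ q, difs (List.replicate r s) a q ≠ difs (List.replicate r s) b q) ∧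
      ∀ U ∈ 𝓝 a, ∀ k₀ : ℕ, ∃ k ≥ k₀, sh (k • s) a ∈ U := by
  classical
  obtain ⟨Z, hZY, hZ⟩ := exists_isMinimalFor hY hne hinv
  obtain ⟨a, ha⟩ := hZ.nonempty
  set Δ : AddMonoid.End (G → ℝ) := difs (List.replicate r s) with hΔ
  have hcont : Continuous Δ := continuous_difs _
  have hbd : ∀ x ∈ Z, ∀ y ∈ Z, ∀ p, |(x - y) p| ≤ B + B := fun x hx y hy p =>
    (abs_sub _ _).trans (add_le_add (hB x (hZY hx) p) (hB y (hZY hy) p))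
  have hΔper : ∀ x ∈ Z, ∀ y ∈ Z, ∀ p, ∀ i : ℤ, Δ (x - y) (p + i • v) = Δ (x - y) p := by
    intro x hx y hy p i
    refine apply_add_zsmul_of_dif_eq_zero ?_ p i
    rw [hΔ, ← difs_dif, map_sub, hper x (hZY hx), hper y (hZY hy), sub_zero, map_zero]
  have hΔint : ∀ x ∈ Z, ∀ y ∈ Z, ∀ p, Δ (x - y) p = 0 ∨ 1 ≤ |Δ (x - y) p| := by
    intro x hx y hy p
    obtain ⟨z, hz⟩ := hint x (hZY hx) p
    obtain ⟨z', hz'⟩ := hint y (hZY hy) p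
    rw [map_sub, Pi.sub_apply, hz, hz', ← Int.cast_sub, ← Int.cast_abs]
    rcases eq_or_ne (z - z') 0 with h | h
    · left; rw [h]; simp
    · right; exact_mod_cast Int.one_le_abs h
  by_cases hA : ∃ k : ℕ, 1 ≤ k ∧ ∀ p, η p ≤ 0 → Δ (sh (k • s) a - a) p = 0
  · left
    obtain ⟨k, hk, h0⟩ := hA
    have hka := sh_nsmul_mem hZ.sh_mem k ha
    have hP : ∀ p ∈ {p : G | η p ≤ 0}, p + -s ∈ {p : G | η p ≤ 0} := by
      intro p hp
      simp only [Set.mem_ofPred_eq, map_add, map_neg] at hp ⊢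
      linarith
    have habs : ∀ p, ∃ n : ℕ, p + n • -s ∈ {p : G | η p ≤ 0} := by
      intro p
      refine ⟨(η p).natAbs, ?_⟩
      simp only [Set.mem_ofPred_eq, map_add, map_nsmul, map_neg, nsmul_eq_mul]
      have : η p ≤ (η p).natAbs := Int.le_natAbs
      nlinarith
    have h1 := dif_eq_zero_of_difs_replicate hP r (hbd _ hka _ ha) (by
      intro p hp
      rw [difs_replicate_neg]
      have : η (p - r • s) ≤ 0 := by
        simp only [map_sub, map_nsmul, nsmul_eq_mul]
        have : 0 ≤ (r : ℤ) * η s := by positivity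
        have hp' : η p ≤ 0 := hp
        linarith
      rw [← hΔ, h0 _ this, smul_zero])
    have h2 := hZ.eqOn_of_dif_sub_eq_zero (Or.inr rfl) hP habs ha hka h1
    obtain ⟨z, hz, hzl⟩ := hZ.exists_tendsto hZ.sh_neg_mem ha
    refine ⟨z, hZY hz, k, hk, ?_⟩
    ext p
    refine tendsto_nhds_unique (hzl (p + k • s)) ((hzl p).congr' (Nat.hyperfilter_le_atTop ?_))
    obtain ⟨N, hN⟩ := habs p
    have hPn : ∀ n ≥ N, p + n • -s ∈ {p : G | η p ≤ 0} := by
      intro n hn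
      induction n, hn using Nat.le_induction with
      | base => exact hN
      | succ n _ ih => rw [succ_nsmul, ← add_assoc]; exact hP _ ih
    filter_upwards [eventually_ge_atTop N] with n hn
    have := h2 _ (hPn n hn)
    rw [← this, sh_apply, add_right_comm]
  · right
    push Not at hA
    obtain ⟨F₀, hF₀⟩ := hrep (-η s) 0
    set C : ℕ → Set ((G → ℝ) × (G → ℝ)) := fun L =>
      {x | (x.1 ∈ Z ∧ x.2 ∈ Z) ∧ (∀ p, 0 < η p ∧ η p ≤ L → Δ (x.1 - x.2) p = 0) ∧
        ∃ f ∈ F₀, 1 ≤ |Δ (x.1 - x.2) f|} with hC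
    have hcont' : ∀ p, Continuous fun x : (G → ℝ) × (G → ℝ) => Δ (x.1 - x.2) p := fun p =>
      (continuous_apply p).comp (hcont.comp (continuous_fst.sub continuous_snd))
    have hCclosed : ∀ L, IsClosed (C L) := by
      intro L
      have h1 : IsClosed {x : (G → ℝ) × (G → ℝ) |
          ∀ p, 0 < η p ∧ η p ≤ L → Δ (x.1 - x.2) p = 0} := by
        simp only [Set.ofPred_forall]
        exact isClosed_iInter fun p => isClosed_iInter fun _ =>
          isClosed_eq (hcont' p) continuous_const
      have h2 : IsClosed {x : (G → ℝ) × (G → ℝ) | ∃ f ∈ F₀, 1 ≤ |Δ (x.1 - x.2) f|} := by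
        have : {x : (G → ℝ) × (G → ℝ) | ∃ f ∈ F₀, 1 ≤ |Δ (x.1 - x.2) f|} =
            ⋃ f ∈ F₀, {x | 1 ≤ |Δ (x.1 - x.2) f|} := by ext; simp
        rw [this]
        exact F₀.finite_toSet.isClosed_biUnion fun f _ =>
          isClosed_le continuous_const (hcont' f).abs
      exact ((hZ.isCompact.prod hZ.isCompact).isClosed).inter (h1.inter h2)
    obtain ⟨⟨x, y⟩, hxy⟩ := IsCompact.nonempty_iInter_of_sequence_nonempty_isCompact_isClosed C
      (by
        rintro L ⟨x, y⟩ ⟨h1, h2, h3⟩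
        refine ⟨h1, fun p hp => h2 p ⟨hp.1, hp.2.trans ?_⟩, h3⟩
        push_cast
        linarith)
      (by
        intro L
        obtain ⟨F, hF⟩ := hrep 0 L
        obtain ⟨k, hk, hkU⟩ := hZ.recurrent ha (U := {x | ∀ f ∈ F, |Δ (x - a) f| < 1}) (by
          refine IsOpen.mem_nhds ?_ (by simp)
          simp only [Set.ofPred_forall]
          refine isOpen_biInter_finset fun f _ => isOpen_lt ?_ continuous_const
          exact ((continuous_apply f).comp
            (hcont.comp (continuous_id.sub continuous_const))).abs) 1
        have hka := sh_nsmul_mem hZ.sh_mem k ha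
        have hstrip : ∀ p, 0 < η p → η p ≤ L → Δ (sh (k • s) a - a) p = 0 := by
          intro p hp hp'
          obtain ⟨f, hf, i, rfl⟩ := hF p hp hp'
          rw [hΔper _ hka _ ha]
          refine (hΔint _ hka _ ha f).resolve_right ?_
          exact not_le.2 (hkU f hf)
        obtain ⟨p₁, hp₁, hp₁'⟩ := hA k hk
        obtain ⟨t, ⟨p₀, hp₀, ht0, hne0⟩, hmax⟩ := Int.exists_greatest_of_bdd
          (P := fun t => ∃ p, η p = t ∧ t ≤ 0 ∧ Δ (sh (k • s) a - a) p ≠ 0)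
          ⟨0, fun z hz => by obtain ⟨_, _, h, _⟩ := hz; exact h⟩ ⟨η p₁, p₁, rfl, hp₁, hp₁'⟩
        set m : ℕ := (-t / η s).toNat with hm
        have hmc : (m : ℤ) = -t / η s := Int.toNat_of_nonneg (Int.ediv_nonneg (by linarith) hs.le)
        have hm1 : -t - η s < m * η s := by
          rw [hmc]
          have := Int.lt_ediv_add_one_mul_self (-t) hs
          linarith
        have hm2 : m * η s ≤ -t := by
          rw [hmc]
          exact Int.ediv_mul_le _ hs.ne'
        have e : Δ (sh (m • -s) (sh (k • s) a) - sh (m • -s) a) =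
            sh (m • -s) (Δ (sh (k • s) a - a)) := by
          rw [hΔ, ← difs_sh]
          rfl
        have hx := sh_nsmul_mem hZ.sh_neg_mem m hka
        have hy := sh_nsmul_mem hZ.sh_neg_mem m ha
        refine ⟨(sh (m • -s) (sh (k • s) a), sh (m • -s) a), ⟨hx, hy⟩, ?_, ?_⟩
        · rintro p ⟨hp, hp'⟩
          simp only [e, sh_apply]
          have hη : η (p + m • -s) = η p - m * η s := by
            simp only [map_add, map_nsmul, map_neg, nsmul_eq_mul]; ring
          rcases lt_or_ge 0 (η (p + m • -s)) with h | h
          · refine hstrip _ h ?_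
            rw [hη]
            have : 0 ≤ (m : ℤ) * η s := by positivity
            linarith
          · by_contra hne
            have := hmax _ ⟨_, rfl, h, hne⟩
            rw [hη] at this
            linarith
        · obtain ⟨f, hf, i, hfi⟩ := hF₀ (p₀ + m • s)
            (by simp only [map_add, map_nsmul, nsmul_eq_mul, hp₀]; linarith)
            (by simp only [map_add, map_nsmul, nsmul_eq_mul, hp₀]; linarith)
          refine ⟨f, hf, (hΔint _ hx _ hy f).resolve_left ?_⟩
          rw [← hΔper _ hx _ hy f i, ← hfi, e, sh_apply]
          simpa using hne0)
      ((hZ.isCompact.prod hZ.isCompact).of_isClosed_subset (hCclosed 0) fun x hx => hx.1)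
      hCclosed
    rw [Set.mem_iInter] at hxy
    obtain ⟨⟨hx, hy⟩, -, f, hf, hne'⟩ := hxy 0
    simp only at hx hy hne'
    have hP : ∀ p ∈ {p : G | 0 < η p}, p + s ∈ {p : G | 0 < η p} := by
      intro p hp
      simp only [Set.mem_ofPred_eq, map_add] at hp ⊢
      linarith
    refine ⟨x, hZY hx, y, hZY hy, ?_, ⟨f, ?_⟩, fun U hU k₀ => hZ.recurrent hx hU k₀⟩
    · refine hZ.eqOn_of_dif_sub_eq_zero (P := {p : G | 0 < η p}) (Or.inl rfl) hP ?_ hy hx ?_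
      · intro p
        refine ⟨(η p).natAbs + 1, ?_⟩
        simp only [Set.mem_ofPred_eq, map_add, map_nsmul, nsmul_eq_mul]
        have : -η p ≤ |η p| := neg_le_abs _
        push_cast
        nlinarith [abs_nonneg (η p)]
      · refine dif_eq_zero_of_difs_replicate hP r (hbd _ hx _ hy) fun p hp => ?_
        obtain ⟨-, h, -⟩ := hxy (η p).toNat
        exact h p ⟨hp, Int.self_le_toNat _⟩
    · intro heq
      rw [map_sub, Pi.sub_apply, heq, sub_self, abs_zero] at hne'
      linarith

end Asymptotic

section Decomposes

open Filter Topology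

variable {G A : Type*} [AddCommGroup G]

theorem difs_intCast (l : List G) (f : G → ℤ) (p : G) :
    difs l (fun p => (f p : ℝ)) p = (difs l f p : ℤ) := by
  induction l generalizing p with
  | nil => rfl
  | cons v l ih => simp only [difs_cons, dif_apply, ih, Int.cast_sub]

theorem difs_eq_difs_replicate {E : Type*} [AddCommGroup E] {s v : G} {a : G → E}
    (ha : dif v a = 0) (l : List G) (hl : ∀ x ∈ l, ∃ c : ℤ, x = s - c • v) :
    difs l a = difs (List.replicate l.length s) a := by
  induction l with
  | nil => rfl
  | cons x l ih =>
    obtain ⟨c, rfl⟩ := hl x (by simp)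
    rw [difs_cons, ih fun x hx => hl x (List.mem_cons_of_mem _ hx), List.length_cons,
      List.replicate_succ, difs_cons]
    have hper : dif v (difs (List.replicate l.length s) a) = 0 := by
      rw [← difs_dif, ha, map_zero]
    ext p
    have := apply_add_zsmul_of_dif_eq_zero hper (p + s) (-c)
    rw [dif_apply, dif_apply, ← this, neg_smul, add_assoc, sub_eq_add_neg s]

theorem difs_replicate_congr {E : Type*} [AddCommGroup E] {s : G} {P : Set G}
    (hP : ∀ p ∈ P, p + s ∈ P) {a b : G → E} (h : ∀ p ∈ P, a p = b p) (r : ℕ) :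
    ∀ p ∈ P, difs (List.replicate r s) a p = difs (List.replicate r s) b p := by
  induction r with
  | zero => exact h
  | succ r ih =>
    intro p hp
    simp only [List.replicate_succ, difs_cons, dif_apply, ih p hp, ih _ (hP p hp)]

/-- The configuration `d`, seen through `φ`, is the sum of a bounded `v`-periodic function `a` and
of bounded `u j`-periodic functions `b j`. -/
structure Decomposes {m : ℕ} (φ : A → ℤ) (B : ℝ) (v : G) (u : Fin m → G) (d : G → A) (a : G → ℝ)
    (b : Fin m → G → ℝ) : Prop where
  abs_le : ∀ p, |a p| ≤ B
  abs_le' : ∀ j p, |b j p| ≤ B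
  dif_eq : dif v a = 0
  dif_eq' : ∀ j, dif (u j) (b j) = 0
  eq_sum : ∀ p, (φ (d p) : ℝ) = a p + ∑ j, b j p

namespace Decomposes

variable {m : ℕ} {φ : A → ℤ} {B : ℝ} {s v : G} {u : Fin m → G} {d : G → A} {a : G → ℝ}
  {b : Fin m → G → ℝ}

theorem sh (h : Decomposes φ B v u d a b) (t : G) :
    Decomposes φ B v u (sh t d) (sh t a) (fun j => sh t (b j)) where
  abs_le p := h.abs_le _
  abs_le' j p := h.abs_le' j _
  dif_eq := by
    rw [show dif v (_root_.sh t a) = _root_.sh t (dif v a) from dif_shift v a t, h.dif_eq]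
    rfl
  dif_eq' j := by
    rw [show dif (u j) (_root_.sh t (b j)) = _root_.sh t (dif (u j) (b j)) from
      dif_shift (u j) (b j) t, h.dif_eq']
    rfl
  eq_sum p := h.eq_sum _

theorem difs_eq (h : Decomposes φ B v u d a b) {c : Fin m → ℤ} (hu : ∀ j, u j = s - c j • v)
    (p : G) : difs (List.replicate m s) a p = (difs (List.ofFn u) (fun p => φ (d p)) p : ℤ) := by
  have h1 : (fun p => (φ (d p) : ℝ)) = a + ∑ j, b j := by
    ext p
    simp [h.eq_sum p]
  have h2 := difs_eq_difs_replicate h.dif_eq (s := s) (List.ofFn u) (by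
    intro x hx
    obtain ⟨j, rfl⟩ := List.mem_ofFn.1 hx
    exact ⟨c j, hu j⟩)
  rw [List.length_ofFn] at h2
  rw [← difs_intCast, h1, map_add, map_sum, ← h2, Finset.sum_eq_zero, add_zero]
  intro j _
  exact difs_eq_zero_of_mem (List.mem_ofFn.2 ⟨j, rfl⟩) (h.dif_eq' j)

end Decomposes

theorem isCompact_setOf_decomposes [Finite A] [TopologicalSpace A] [DiscreteTopology A] {m : ℕ}
    (φ : A → ℤ) (B : ℝ) (v : G) (u : Fin m → G) {X : Set (G → A)} (hX : IsClosed X) :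
    IsCompact {x : (G → A) × (G → ℝ) × (Fin m → G → ℝ) |
      x.1 ∈ X ∧ Decomposes φ B v u x.1 x.2.1 x.2.2} := by
  have hK : IsCompact (X ×ˢ ((Set.univ.pi fun _ : G => Set.Icc (-B) B) ×ˢ
      (Set.univ.pi fun _ : Fin m => Set.univ.pi fun _ : G => Set.Icc (-B) B))) :=
    hX.isCompact.prod ((isCompact_univ_pi fun _ => isCompact_Icc).prod
      (isCompact_univ_pi fun _ => isCompact_univ_pi fun _ => isCompact_Icc))
  have hdif : ∀ w : G, Continuous (dif w : (G → ℝ) → G → ℝ) := fun w => continuous_difs [w]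
  have h1 : IsClosed {x : (G → A) × (G → ℝ) × (Fin m → G → ℝ) | dif v x.2.1 = 0} :=
    isClosed_eq ((hdif v).comp (by fun_prop)) continuous_const
  have h2 : IsClosed {x : (G → A) × (G → ℝ) × (Fin m → G → ℝ) | ∀ j, dif (u j) (x.2.2 j) = 0} := by
    simp only [Set.ofPred_forall]
    exact isClosed_iInter fun j => isClosed_eq ((hdif (u j)).comp (by fun_prop)) continuous_const
  have h3 : IsClosed {x : (G → A) × (G → ℝ) × (Fin m → G → ℝ) |
      ∀ p, (φ (x.1 p) : ℝ) = x.2.1 p + ∑ j, x.2.2 j p} := by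
    simp only [Set.ofPred_forall]
    refine isClosed_iInter fun p => isClosed_eq ?_ (by fun_prop)
    exact (continuous_of_discreteTopology (f := fun y : A => (φ y : ℝ))).comp (by fun_prop)
  refine hK.of_isClosed_subset ?_ ?_
  swap
  · rintro ⟨d, a, b⟩ ⟨hd, h⟩
    exact ⟨hd, fun p _ => _root_.abs_le.1 (h.abs_le p),
      fun j _ p _ => _root_.abs_le.1 (h.abs_le' j p)⟩
  · convert hK.isClosed.inter (h1.inter (h2.inter h3)) using 1
    ext ⟨d, a, b⟩
    constructor
    · rintro ⟨hd, h⟩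
      exact ⟨⟨hd, fun p _ => _root_.abs_le.1 (h.abs_le p),
        fun j _ p _ => _root_.abs_le.1 (h.abs_le' j p)⟩, h.dif_eq, h.dif_eq', h.eq_sum⟩
    · rintro ⟨⟨hd, ha, hb⟩, h1, h2, h3⟩
      exact ⟨hd, fun p => _root_.abs_le.2 (ha p trivial),
        fun j p => _root_.abs_le.2 (hb j trivial p trivial), h1, h2, h3⟩

end Decomposes

section IPRecurrence

open Filter Topology

variable {G : Type*} [AddCommGroup G]

theorem exists_ip_recurrence {s : G} {a : G → ℝ}
    (ha : ∀ U ∈ 𝓝 a, ∀ k₀ : ℕ, ∃ k ≥ k₀, sh (k • s) a ∈ U) {U : Set (G → ℝ)} (hU : IsOpen U)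
    (haU : a ∈ U) (k₀ : ℕ) {ι : Type*} (S : Finset ι) :
    ∃ k : ι → ℕ, (∀ i, k₀ ≤ k i) ∧ ∀ I ⊆ S, sh ((∑ i ∈ I, k i) • s) a ∈ U := by
  classical
  induction S using Finset.induction_on with
  | empty =>
    refine ⟨fun _ => k₀, fun _ => le_rfl, fun I hI => ?_⟩
    rw [Finset.subset_empty.1 hI]
    simpa using haU
  | insert i S hi ih =>
    obtain ⟨k, hk, h⟩ := ih
    have hopen : IsOpen (⋂ I ∈ S.powerset, sh ((∑ i ∈ I, k i) • s) ⁻¹' U) :=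
      isOpen_biInter_finset fun I _ => hU.preimage (continuous_sh _)
    obtain ⟨l, hl, hlU⟩ := ha _ (hopen.mem_nhds (by simpa using h)) k₀
    simp only [Finset.mem_powerset, Set.mem_iInter, Set.mem_preimage, sh_sh] at hlU
    have hsum : ∀ I ⊆ S, ∑ j ∈ I, Function.update k i l j = ∑ j ∈ I, k j := fun I hI =>
      Finset.sum_congr rfl fun j hj =>
        Function.update_of_ne (fun h : j = i => hi (h ▸ hI hj)) _ _
    refine ⟨Function.update k i l, fun j => ?_, fun I hI => ?_⟩
    · rcases eq_or_ne j i with rfl | hj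
      · simpa using hl
      · simpa [hj] using hk j
    · by_cases hiI : i ∈ I
      · have hI' : I.erase i ⊆ S := by
          intro x hx
          rw [Finset.mem_erase] at hx
          exact (Finset.mem_insert.1 (hI hx.2)).resolve_left hx.1
        rw [← Finset.sum_erase_add _ _ hiI, hsum _ hI', Function.update_self, add_smul]
        exact hlU _ hI'
      · have hI' : I ⊆ S := fun x hx =>
          (Finset.mem_insert.1 (hI hx)).resolve_left fun h => hiI (h ▸ hx)
        rw [hsum _ hI']
        exact h I hI'

end IPRecurrence

section Deterministic

open Filter Topology

variable {G A : Type*} [AddCommGroup G] [Finite A] [TopologicalSpace A] [DiscreteTopology A]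

theorem exists_finset_of_deterministic {X : Set (G → A)} (hX : IsClosed X) {P : Set G}
    (hdet : ∀ d ∈ X, ∀ e ∈ X, (∀ p ∈ P, d p = e p) → d = e) (φ : A → ℤ) (l : List G) (q : G) :
    ∃ W : Finset G, (∀ w ∈ W, w ∈ P) ∧ ∀ d ∈ X, ∀ e ∈ X, (∀ w ∈ W, d w = e w) →
      difs l (fun p => φ (d p)) q = difs l (fun p => φ (e p)) q := by
  classical
  have hφ : Continuous fun d : G → A => fun p => φ (d p) := continuous_pi fun p =>
    continuous_of_discreteTopology.comp (continuous_apply p)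
  have hc : Continuous fun d : G → A => difs l (fun p => φ (d p)) q :=
    (continuous_apply q).comp ((continuous_difs l).comp hφ)
  have hclosed : IsClosed {x : (G → A) × (G → A) |
      difs l (fun p => φ (x.1 p)) q ≠ difs l (fun p => φ (x.2 p)) q} :=
    (isClosed_discrete {y : ℤ × ℤ | y.1 ≠ y.2}).preimage
      ((hc.comp continuous_fst).prodMk (hc.comp continuous_snd))
  have hK := (hX.prod hX).inter hclosed |>.isCompact
  obtain ⟨W, hW⟩ := hK.elim_finite_subfamily_closed
    (fun w : P => {x : (G → A) × (G → A) | x.1 w = x.2 w})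
    (fun w => isClosed_eq (by fun_prop) (by fun_prop)) (by
      rw [Set.eq_empty_iff_forall_notMem]
      rintro ⟨d, e⟩ ⟨⟨hde, hne⟩, h⟩
      rw [Set.mem_iInter] at h
      obtain rfl : d = e := hdet d hde.1 e hde.2 fun p hp => h ⟨p, hp⟩
      exact hne rfl)
  refine ⟨W.image Subtype.val, fun w hw => by
    obtain ⟨x, -, rfl⟩ := Finset.mem_image.1 hw
    exact x.2, fun d hd e he h => ?_⟩
  by_contra hne
  have : (d, e) ∈ (∅ : Set ((G → A) × (G → A))) := by
    rw [← hW]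
    refine ⟨⟨⟨hd, he⟩, hne⟩, ?_⟩
    simp only [Set.mem_iInter]
    intro w hw
    exact h w (Finset.mem_image_of_mem _ hw)
  exact this

/-- A Hales–Jewett argument: along a suitable combinatorial line, finitely many functions with
finitely many approximate values return close to themselves. -/
theorem exists_common_return {m : ℕ} (c : Fin m → ℤ) {v : G} (W : Finset G) {B : ℝ}
    {ε : ℝ} (hε : 0 < ε) :
    ∃ ι : Type, ∃ _ : Fintype ι, ∀ (b : Fin m → G → ℝ), (∀ j p, |b j p| ≤ B) → ∀ (k : ι → ℕ),
      ∃ I : Finset ι, I.Nonempty ∧ ∃ t : ℤ, ∀ j, ∀ w ∈ W,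
        |b j (w + t • v + ((∑ i ∈ I, k i : ℕ) * c j : ℤ) • v) - b j (w + t • v)| < ε := by
  classical
  obtain ⟨ι, hι, hHJ⟩ := Combinatorics.Line.exists_mono_in_high_dimension (Option (Fin m))
    (Fin m → W → Set.Icc ⌊-B / ε⌋ ⌊B / ε⌋)
  refine ⟨ι, hι, fun b hB k => ?_⟩
  set T : (ι → Option (Fin m)) → ℤ := fun ω => ∑ i, (k i : ℤ) * (ω i).elim 0 c with hT
  obtain ⟨l, hl⟩ := hHJ fun ω j w => ⟨⌊b j (w + T ω • v) / ε⌋,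
    Int.floor_le_floor (div_le_div_of_nonneg_right (abs_le.1 (hB _ _)).1 hε.le),
    Int.floor_le_floor (div_le_div_of_nonneg_right (abs_le.1 (hB _ _)).2 hε.le)⟩
  obtain ⟨y, hy⟩ := hl
  refine ⟨Finset.univ.filter fun i => l.idxFun i = none, ?_, T (l none), ?_⟩
  · obtain ⟨i, hi⟩ := l.proper
    exact ⟨i, by simpa using hi⟩
  · intro j w hw
    have hTj : T (l (some j)) = T (l none) +
        ((∑ i ∈ Finset.univ.filter fun i => l.idxFun i = none, k i : ℕ) * c j : ℤ) := by
      rw [hT]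
      push_cast
      rw [Finset.sum_filter, Finset.sum_mul, ← Finset.sum_add_distrib]
      refine Finset.sum_congr rfl fun i _ => ?_
      rw [Combinatorics.Line.coe_apply, Combinatorics.Line.coe_apply]
      cases h : l.idxFun i <;> simp
    have h1 := congrFun (congrFun ((hy (some j)).trans (hy none).symm) j) ⟨w, hw⟩
    have h2 := Int.abs_sub_lt_one_of_floor_eq_floor (Subtype.ext_iff.1 h1)
    rw [← sub_div, abs_div, abs_of_pos hε, div_lt_one hε, hTj, add_smul, ← add_assoc] at h2
    exact h2

theorem exists_periodic_component_of_deterministic (η : G →+ ℤ) {s v : G} (hs : 0 < η s)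
    (hrep : ∀ l h : ℤ, ∃ F : Finset G, ∀ p, l < η p → η p ≤ h → ∃ f ∈ F, ∃ i : ℤ, p = f + i • v)
    {φ : A → ℤ} (hφ : Function.Injective φ) {X : Set (G → A)} (hX : IsClosed X)
    (hne : X.Nonempty) (hinv : ∀ t, ∀ d ∈ X, sh t d ∈ X) {m : ℕ} {c : Fin m → ℤ}
    {u : Fin m → G} (hu : ∀ j, u j = s - c j • v) {B : ℝ}
    (hdec : ∀ d ∈ X, ∃ a b, Decomposes φ B v u d a b)
    (hdet : ∀ d ∈ X, ∀ e ∈ X, (∀ p, 0 < η p → d p = e p) → d = e) :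
    ∃ d ∈ X, ∃ a b, Decomposes φ B v u d a b ∧ ∃ k : ℕ, 1 ≤ k ∧ sh (k • s) a = a := by
  classical
  have hΩ := isCompact_setOf_decomposes φ B v u hX
  set Ω := {x : (G → A) × (G → ℝ) × (Fin m → G → ℝ) |
      x.1 ∈ X ∧ Decomposes φ B v u x.1 x.2.1 x.2.2} with hΩdef
  obtain ⟨d₀, hd₀⟩ := hne
  obtain ⟨a₀, b₀, h₀⟩ := hdec d₀ hd₀
  rcases exists_periodic_or_asymptotic η hs hrep (Y := (fun x => x.2.1) '' Ω)
    (hΩ.image (by fun_prop)) ⟨a₀, ⟨d₀, a₀, b₀⟩, ⟨hd₀, h₀⟩, rfl⟩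
    (by
      rintro _ ⟨⟨d, a, b⟩, ⟨hd, h⟩, rfl⟩
      exact ⟨⟨sh s d, sh s a, fun j => sh s (b j)⟩, ⟨hinv s d hd, h.sh s⟩, rfl⟩)
    (B := B) (by
      rintro _ ⟨⟨d, a, b⟩, ⟨hd, h⟩, rfl⟩
      exact h.abs_le)
    (by
      rintro _ ⟨⟨d, a, b⟩, ⟨hd, h⟩, rfl⟩
      exact h.dif_eq) m
    (by
      rintro _ ⟨⟨d, a, b⟩, ⟨hd, h⟩, rfl⟩ p
      exact ⟨_, h.difs_eq hu p⟩) with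
    ⟨_, ⟨⟨d, a, b⟩, ⟨hd, h⟩, rfl⟩, hk⟩ |
    ⟨a, ⟨⟨da, _, ba⟩, ⟨hda, ha⟩, rfl⟩, a', ⟨⟨d, _, b⟩, ⟨hd, h⟩, rfl⟩, hab, ⟨q, hq⟩, hrec⟩
  · exact ⟨d, hd, a, b, h, hk⟩
  exfalso
  simp only at hab hq hrec ha h
  rename_i a b'
  obtain ⟨W, hWP, hW⟩ := exists_finset_of_deterministic hX (P := {p | 0 < η p}) hdet φ
    (List.ofFn u) q
  set Δ : AddMonoid.End (G → ℝ) := difs (List.replicate m s) with hΔ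
  have hcont : Continuous Δ := continuous_difs _
  set ε : ℝ := ((m : ℝ) + 1)⁻¹ with hεdef
  have hε : 0 < ε := by positivity
  obtain ⟨ι, _, hι⟩ := exists_common_return c (v := v) W (B := B) hε
  have hopen : IsOpen {x : G → ℝ | (∀ w ∈ W, |x w - a w| < ε) ∧ |Δ x q - Δ a q| < 1} := by
    refine IsOpen.inter (s := {x : G → ℝ | ∀ w ∈ W, |x w - a w| < ε}) ?_ ?_
    · simp only [Set.ofPred_forall]
      exact isOpen_biInter_finset fun w _ => isOpen_lt (by fun_prop) continuous_const
    · exact isOpen_lt ((((continuous_apply q).comp hcont).sub continuous_const).abs)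
        continuous_const
  obtain ⟨k, hk₀, hk⟩ := exists_ip_recurrence hrec hopen (by simp [hε]) ((η q).natAbs + 1)
    (Finset.univ : Finset ι)
  obtain ⟨I, ⟨i₀, hi₀⟩, t, ht⟩ := hι b h.abs_le' k
  obtain ⟨hkW, hkq⟩ := hk I (Finset.subset_univ _)
  set K : ℕ := ∑ i ∈ I, k i with hK
  have hKη : 0 < η (q + K • s) := by
    have h1 : k i₀ ≤ K := Finset.single_le_sum (f := k) (fun _ _ => Nat.zero_le _) hi₀
    have h2 := hk₀ i₀
    have h3 : ((η q).natAbs : ℤ) + 1 ≤ K := by exact_mod_cast h2.trans h1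
    simp only [map_add, map_nsmul, nsmul_eq_mul]
    have h4 : -η q ≤ |η q| := neg_le_abs _
    rw [Int.natCast_natAbs] at h3
    nlinarith [abs_nonneg (η q)]
  have hKη' : ∀ w ∈ W, 0 < η (w + K • s) := by
    intro w hw
    have h1 : 0 < η w := hWP w hw
    simp only [map_add, map_nsmul, nsmul_eq_mul]
    positivity
  have hper : ∀ p, ∀ i : ℤ, b' (p + i • v) = b' p := apply_add_zsmul_of_dif_eq_zero h.dif_eq
  have hP : ∀ p ∈ {p : G | 0 < η p}, p + s ∈ {p : G | 0 < η p} := by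
    intro p hp
    simp only [Set.mem_ofPred_eq, map_add] at hp ⊢
    linarith
  have hΔab : ∀ p, 0 < η p → Δ a p = Δ b' p :=
    difs_replicate_congr (P := {p : G | 0 < η p}) hP hab m
  have hagree : ∀ w ∈ W, sh (t • v) d w = sh (t • v + K • s) d w := by
    intro w hw
    apply hφ
    have h1 := h.eq_sum (w + t • v)
    have h2 := h.eq_sum (w + (t • v + K • s))
    have h3 : |b' (w + (t • v + K • s)) - b' (w + t • v)| < ε := by
      have e : w + (t • v + K • s) = w + K • s + t • v := by abel
      rw [e, hper, hper, ← hab _ (hKη' w hw), ← hab w (hWP w hw)]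
      exact hkW w hw
    have h4 : ∀ j, |b j (w + (t • v + K • s)) - b j (w + t • v)| < ε := by
      intro j
      have e : w + (t • v + K • s) = w + t • v + ((K : ℤ) * c j) • v + (K : ℤ) • u j := by
        rw [hu, smul_sub, mul_smul]
        simp only [natCast_zsmul]
        abel
      rw [e, apply_add_zsmul_of_dif_eq_zero (h.dif_eq' j)]
      exact ht j w hw
    have h5 : |((φ (d (w + (t • v + K • s))) - φ (d (w + t • v)) : ℤ) : ℝ)| < 1 := by
      have e : ((φ (d (w + (t • v + K • s))) - φ (d (w + t • v)) : ℤ) : ℝ) =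
          (b' (w + (t • v + K • s)) - b' (w + t • v)) +
          ∑ j, (b j (w + (t • v + K • s)) - b j (w + t • v)) := by
        push_cast
        rw [h1, h2, Finset.sum_sub_distrib]
        ring
      rw [e]
      calc _ ≤ |b' (w + (t • v + K • s)) - b' (w + t • v)| +
            ∑ j, |b j (w + (t • v + K • s)) - b j (w + t • v)| :=
            (abs_add_le _ _).trans (add_le_add_right (Finset.abs_sum_le_sum_abs _ _) _)
        _ < ε + ∑ j : Fin m, ε :=
            add_lt_add_of_lt_of_le h3 (Finset.sum_le_sum fun j _ => (h4 j).le)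
        _ = 1 := by
            rw [Finset.sum_const, Finset.card_univ, Fintype.card_fin, nsmul_eq_mul, hεdef]
            field_simp
            ring
    rw [← Int.cast_abs] at h5
    have h6 : |φ (d (w + (t • v + K • s))) - φ (d (w + t • v))| < 1 := by exact_mod_cast h5
    rw [Int.abs_lt_one_iff, sub_eq_zero] at h6
    exact h6.symm
  have hq1 := hW _ (hinv (t • v) d hd) _ (hinv (t • v + K • s) d hd) hagree
  have hq2 := (h.sh (t • v)).difs_eq hu q
  have hq3 := (h.sh (t • v + K • s)).difs_eq hu q
  rw [hq1, ← hq3, ← hΔ, hΔ, difs_sh, difs_sh, ← hΔ, sh_apply, sh_apply] at hq2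
  have hΔper : ∀ p, ∀ i : ℤ, Δ b' (p + i • v) = Δ b' p := apply_add_zsmul_of_dif_eq_zero (by
    rw [hΔ, ← difs_dif, h.dif_eq, map_zero])
  have e : q + (t • v + K • s) = q + K • s + t • v := by abel
  rw [e, hΔper, hΔper, ← hΔab _ hKη] at hq2
  apply hq
  rw [hq2]
  rw [hΔ, difs_sh, ← hΔ, sh_apply] at hkq
  obtain ⟨z1, hz1⟩ : ∃ z : ℤ, Δ a (q + K • s) = z := ⟨_, ha.difs_eq hu _⟩
  obtain ⟨z2, hz2⟩ : ∃ z : ℤ, Δ a q = z := ⟨_, ha.difs_eq hu _⟩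
  rw [hz1, hz2, ← Int.cast_sub, ← Int.cast_abs] at hkq
  have h6 : |z1 - z2| < 1 := by exact_mod_cast hkq
  rw [Int.abs_lt_one_iff, sub_eq_zero] at h6
  rw [hz1, hz2, h6]

end Deterministic

section PlaneGeometry

/-- The determinant form `p ↦ det (w, p)`, whose level lines are parallel to `w`. -/
def detForm (w : ℤ × ℤ) : ℤ × ℤ →+ ℤ where
  toFun p := w.1 * p.2 - w.2 * p.1
  map_zero' := by simp
  map_add' p q := by simp only [Prod.fst_add, Prod.snd_add]; ring

theorem detForm_apply (w p : ℤ × ℤ) : detForm w p = w.1 * p.2 - w.2 * p.1 := rfl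

theorem detForm_neg (w p : ℤ × ℤ) : detForm (-w) p = -detForm w p := by
  simp only [detForm_apply, Prod.fst_neg, Prod.snd_neg]; ring

theorem exists_eq_smul_of_detForm_eq_zero {w p : ℤ × ℤ} (hw : IsCoprime w.1 w.2)
    (h : detForm w p = 0) : ∃ i : ℤ, p = i • w := by
  obtain ⟨x, y, hxy⟩ := hw
  rw [detForm_apply] at h
  refine ⟨x * p.1 + y * p.2, Prod.ext ?_ ?_⟩
  · simp only [Prod.smul_fst, smul_eq_mul]
    linear_combination -p.1 * hxy - y * h
  · simp only [Prod.smul_snd, smul_eq_mul]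
    linear_combination -p.2 * hxy + x * h

theorem exists_detForm_eq_one {w : ℤ × ℤ} (hw : IsCoprime w.1 w.2) : ∃ z, detForm w z = 1 := by
  obtain ⟨x, y, hxy⟩ := hw
  exact ⟨(-y, x), by rw [detForm_apply]; linarith⟩

theorem detForm_smul_self (w : ℤ × ℤ) (i : ℤ) : detForm w (i • w) = 0 := by
  simp only [detForm_apply, Prod.smul_fst, Prod.smul_snd, smul_eq_mul]; ring

theorem exists_eq_smul_isCoprime {v : ℤ × ℤ} (hv : v ≠ 0) :
    ∃ w : ℤ × ℤ, IsCoprime w.1 w.2 ∧ ∃ g : ℤ, g ≠ 0 ∧ v = g • w := by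
  have h : v.1 ≠ 0 ∨ v.2 ≠ 0 := by
    by_contra! h
    exact hv (Prod.ext h.1 h.2)
  have hg : Int.gcd v.1 v.2 ≠ 0 := by rwa [Ne, Int.gcd_eq_zero_iff, not_and_or]
  obtain ⟨a, b, hab, h1, h2⟩ := Int.exists_gcd_one (Nat.pos_of_ne_zero hg)
  exact ⟨(a, b), Int.isCoprime_iff_gcd_eq_one.2 hab, Int.gcd v.1 v.2, by exact_mod_cast hg,
    Prod.ext (by simpa [mul_comm] using h1) (by simpa [mul_comm] using h2)⟩

theorem exists_strip_representatives {w v : ℤ × ℤ} (hw : IsCoprime w.1 w.2) {g : ℤ} (hg : g ≠ 0)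
    (hv : v = g • w) (l h : ℤ) :
    ∃ F : Finset (ℤ × ℤ), ∀ p, l < detForm w p → detForm w p ≤ h →
      ∃ f ∈ F, ∃ i : ℤ, p = f + i • v := by
  obtain ⟨z, hz⟩ := exists_detForm_eq_one hw
  refine ⟨(Finset.Icc l h ×ˢ Finset.Ico 0 |g|).image fun x => x.1 • z + x.2 • w,
    fun p hl hh => ?_⟩
  have h0 : detForm w (p - detForm w p • z) = 0 := by
    rw [map_sub, map_zsmul, hz]; simp
  obtain ⟨i, hi⟩ := exists_eq_smul_of_detForm_eq_zero hw h0
  refine ⟨detForm w p • z + (i % g) • w, Finset.mem_image.2 ⟨(detForm w p, i % g), ?_, rfl⟩,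
    i / g, ?_⟩
  · simp [hl.le, hh, Int.emod_nonneg _ hg, Int.emod_lt_abs i hg]
  · rw [hv, smul_smul, add_assoc, ← add_smul, mul_comm, Int.emod_add_mul_ediv, ← hi]
    abel

theorem exists_common_transversal {w v : ℤ × ℤ} (hw : IsCoprime w.1 w.2) {g : ℤ} (hg : g ≠ 0)
    (hv : v = g • w) {m : ℕ} (V : Fin m → ℤ × ℤ) (hV : ∀ j, detForm v (V j) ≠ 0) :
    ∃ s, 0 < detForm w s ∧ ∃ c c' : Fin m → ℤ, ∀ j, c' j ≠ 0 ∧ c' j • V j = s - c j • v := by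
  obtain ⟨z, hz⟩ := exists_detForm_eq_one hw
  set M : ℤ := ∏ j, detForm v (V j) ^ 2 with hM
  have hMpos : 0 < M := Finset.prod_pos fun j _ => by have := hV j; positivity
  have hdvd : ∀ j, detForm v (V j) ∣ M := fun j =>
    (dvd_pow_self _ two_ne_zero).trans (Finset.dvd_prod_of_mem _ (Finset.mem_univ j))
  choose q hq using hdvd
  refine ⟨M • z, by rw [map_zsmul, hz]; simpa using hMpos, fun j => q j * detForm z (V j),
    fun j => q j * g, fun j => ⟨mul_ne_zero ?_ hg, ?_⟩⟩
  · intro h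
    have hj := hq j
    rw [h, mul_zero] at hj
    exact hMpos.ne' hj
  · have hvz : v.1 * z.2 - v.2 * z.1 = g := by
      rw [hv]
      rw [detForm_apply] at hz
      simp only [Prod.smul_fst, Prod.smul_snd, smul_eq_mul]
      linear_combination g * hz
    have h := hq j
    rw [h]
    simp only [detForm_apply]
    refine Prod.ext ?_ ?_ <;>
      simp only [Prod.smul_fst, Prod.smul_snd, Prod.fst_sub, Prod.snd_sub, smul_eq_mul]
    · rw [← hvz]; ring
    · rw [← hvz]; ring

end PlaneGeometry

section VanishingOnStrips

variable {G E : Type*} [AddCommGroup G] [AddCommGroup E]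

theorem eq_zero_of_difs_eq_zero_of_strip (η : G →+ ℤ) {H : ℤ} (hH : 0 < H) (l : List G)
    (hl : ∀ x ∈ l, η x = H) {f : G → E} (hf : difs l f = 0) {h₀ : ℤ}
    (h : ∀ p, h₀ < η p → η p ≤ h₀ + l.length * H → f p = 0) : f = 0 := by
  induction l generalizing f with
  | nil => exact hf
  | cons x l ih =>
    have hx : η x = H := hl x (by simp)
    have hdx : dif x f = 0 := by
      refine ih (fun y hy => hl y (List.mem_cons_of_mem _ hy)) (by rw [difs_dif, ← difs_cons, hf])
        fun p hp hp' => ?_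
      simp only [List.length_cons] at h
      push_cast at h
      rw [dif_apply, h p hp (by linarith), h (p + x) (by rw [map_add]; linarith)
        (by rw [map_add]; linarith), sub_zero]
    ext p
    have h1 := apply_add_zsmul_of_dif_eq_zero hdx p (-((η p - h₀ - 1) / H))
    rw [← h1]
    have h2 : 0 ≤ (η p - h₀ - 1) % H := Int.emod_nonneg _ hH.ne'
    have h3 := Int.emod_lt_of_pos (η p - h₀ - 1) hH
    have h4 := Int.emod_add_mul_ediv (η p - h₀ - 1) H
    have h5 : η (p + -((η p - h₀ - 1) / H) • x) = η p - H * ((η p - h₀ - 1) / H) := by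
      rw [map_add, map_zsmul, hx, smul_eq_mul]; ring
    apply h
    · rw [h5]; linarith
    · rw [h5]
      simp only [List.length_cons]
      push_cast
      have : 0 ≤ (l.length : ℤ) * H := by positivity
      linarith

end VanishingOnStrips

section MinimalDecomposition

variable {G A : Type*} [AddCommGroup G]

/-- The configuration `d`, seen through `φ`, is a sum of `n` bounded periodic functions. -/
def IsSumOfPeriodic (φ : A → ℤ) (d : G → A) (n : ℕ) : Prop :=
  ∃ V : Fin n → G, (∀ i, V i ≠ 0) ∧ ∃ (B : ℝ) (g : Fin n → G → ℝ), (∀ i p, |g i p| ≤ B) ∧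
    (∀ i, dif (V i) (g i) = 0) ∧ ∀ p, (φ (d p) : ℝ) = ∑ i, g i p

theorem isSumOfPeriodic_of_difs_eq_zero [Finite A] {φ : A → ℤ} {d : G → A} {V : List G}
    (hV : ∀ v ∈ V, v ≠ 0) (h : difs V (φ ∘ d) = 0) : IsSumOfPeriodic φ d V.length := by
  obtain ⟨B, hB⟩ := (Set.finite_range fun x : A => |(φ x : ℝ)|).bddAbove
  obtain ⟨g, hg, hgV, hsum⟩ := exists_sum_periodic V (fun p => (φ (d p) : ℝ)) (B := B)
    (fun p => hB ⟨d p, rfl⟩) (by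
      ext p
      have h' : difs V (fun p => φ (d p)) p = 0 := congrFun h p
      rw [difs_intCast, h']
      simp)
  choose C hC using hg
  obtain ⟨C', hC'⟩ := (Set.finite_range C).bddAbove
  refine ⟨V.get, fun i => hV _ (List.get_mem _ _), C', g, fun i p => (hC i p).trans (hC' ⟨i, rfl⟩),
    hgV, fun p => ?_⟩
  have := congrFun hsum p
  simpa using this

theorem Decomposes.isSumOfPeriodic_of_absorb {m : ℕ} {φ : A → ℤ} {B : ℝ} {v : G} {u : Fin m → G}
    {d : G → A} {a : G → ℝ} {b : Fin m → G → ℝ} (h : Decomposes φ B v u d a b)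
    (hu : ∀ j, u j ≠ 0) (j₀ : Fin m) {w : G} (hw : w ≠ 0) (ha : dif w a = 0)
    (hb : dif w (b j₀) = 0) : IsSumOfPeriodic φ d m := by
  classical
  have hB : 0 ≤ B := (abs_nonneg _).trans (h.abs_le 0)
  refine ⟨Function.update u j₀ w, fun j => ?_, B + B, Function.update b j₀ (a + b j₀),
    fun j p => ?_, fun j => ?_, fun p => ?_⟩
  · rcases eq_or_ne j j₀ with rfl | hj
    · simpa using hw
    · simpa [hj] using hu j
  · rcases eq_or_ne j j₀ with rfl | hj
    · simpa using (abs_add_le _ _).trans (add_le_add (h.abs_le p) (h.abs_le' j p))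
    · simpa [hj] using (h.abs_le' j p).trans (by linarith)
  · rcases eq_or_ne j j₀ with rfl | hj
    · simp [ha, hb]
    · simpa [hj] using h.dif_eq' j
  · rw [h.eq_sum p, ← Finset.add_sum_erase _ _ (Finset.mem_univ j₀),
      ← Finset.add_sum_erase _ (fun i => Function.update b j₀ (a + b j₀) i p)
        (Finset.mem_univ j₀)]
    have : ∑ x ∈ Finset.univ.erase j₀, Function.update b j₀ (a + b j₀) x p =
        ∑ x ∈ Finset.univ.erase j₀, b x p := Finset.sum_congr rfl fun j hj => by
      rw [Function.update_of_ne (Finset.ne_of_mem_erase hj)]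
    simp [this, add_assoc]

theorem dif_zsmul_eq_zero {E : Type*} [AddCommGroup E] {v : G} {f : G → E} (h : dif v f = 0)
    (k : ℤ) : dif (k • v) f = 0 := by
  ext p
  rw [dif_apply, apply_add_zsmul_of_dif_eq_zero h, sub_self]
  rfl

theorem dif_sub_eq_zero {E : Type*} [AddCommGroup E] {v w : G} {f : G → E} (hv : dif v f = 0)
    (hw : dif w f = 0) : dif (v - w) f = 0 := by
  ext p
  have h1 := apply_add_zsmul_of_dif_eq_zero hw (p + v) (-1)
  have h2 := apply_add_zsmul_of_dif_eq_zero hv p 1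
  rw [one_smul] at h2
  rw [dif_apply, ← h2, ← h1, neg_smul, one_smul, add_assoc, sub_eq_add_neg v w, sub_self]
  rfl

theorem periodic_of_sh_eq {d : ℤ × ℤ → A} {t : ℤ × ℤ} (ht : t ≠ 0) (h : sh t d = d) :
    Periodic d :=
  ⟨-t, neg_ne_zero.2 ht, by
    ext n
    rw [Translate, sub_neg_eq_add]
    exact congrFun h n⟩

/-- A configuration of `X` that is periodic on a strip of height `L` is globally periodic. -/
def StripPeriodicExtends (X : Set (ℤ × ℤ → A)) (w : ℤ × ℤ) : Prop :=
  ∃ L : ℕ, ∀ d ∈ X, ∀ K : ℤ, K ≠ 0 → ∀ h₀ : ℤ,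
    (∀ p, h₀ < detForm w p → detForm w p ≤ h₀ + L → d (p + K • w) = d p) → Periodic d

theorem stripPeriodicExtends_of_decomposes {φ : A → ℤ} (hφ : Function.Injective φ)
    {X : Set (ℤ × ℤ → A)} {w v s : ℤ × ℤ} {g : ℤ} (hg : g ≠ 0) (hw : w ≠ 0) (hv : v = g • w)
    (hs : 0 < detForm w s) {m : ℕ} {c : Fin m → ℤ} {u : Fin m → ℤ × ℤ}
    (hu : ∀ j, u j = s - c j • v) {B : ℝ} (hdec : ∀ d ∈ X, ∃ a b, Decomposes φ B v u d a b) :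
    StripPeriodicExtends X w := by
  refine ⟨m * (detForm w s).toNat, fun d hd K hK h₀ hper => ?_⟩
  obtain ⟨a, b, h⟩ := hdec d hd
  have hper' : ∀ i : ℕ, ∀ p, h₀ < detForm w p →
      detForm w p ≤ h₀ + (m * (detForm w s).toNat : ℕ) → d (p + (i * K : ℤ) • w) = d p := by
    intro i
    induction i with
    | zero => simp
    | succ i ih =>
      intro p hp hp'
      rw [← ih p hp hp']
      have e : p + (((i + 1 : ℕ) : ℤ) * K) • w = p + ((i : ℤ) * K) • w + K • w := by
        push_cast
        rw [add_mul, one_mul, add_smul, add_assoc]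
      have e' : detForm w (p + ((i : ℤ) * K) • w) = detForm w p := by
        rw [map_add, detForm_smul_self, add_zero]
      rw [e, hper _ (by rwa [e']) (by rwa [e'])]
  obtain ⟨i, hi⟩ : ∃ i : ℕ, (i : ℤ) = |g| := ⟨g.natAbs, Int.natCast_natAbs g⟩
  set f : ℤ × ℤ → ℝ := dif ((|g| * K) • w) fun p => (φ (d p) : ℝ) with hf
  have hf0 : f = 0 := by
    refine eq_zero_of_difs_eq_zero_of_strip (detForm w) hs (List.ofFn u) ?_ ?_ (h₀ := h₀) ?_
    · intro x hx
      obtain ⟨j, rfl⟩ := List.mem_ofFn.1 hx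
      rw [hu, hv, map_sub, smul_smul, detForm_smul_self, sub_zero]
    · have h1 : (fun p => (φ (d p) : ℝ)) = a + ∑ j, b j := by
        ext p
        simp [h.eq_sum p]
      have h2 : dif ((|g| * K) • w) a = 0 := by
        have : (|g| * K) • w = (g.sign * K) • v := by
          rw [hv, smul_smul]
          congr 1
          rw [← Int.sign_mul_self_eq_abs]
          ring
        rw [this]
        exact dif_zsmul_eq_zero h.dif_eq _
      rw [hf, h1, map_add, h2, zero_add, difs_dif, map_sum, Finset.sum_eq_zero, map_zero]
      intro j _
      exact difs_eq_zero_of_mem (List.mem_ofFn.2 ⟨j, rfl⟩) (h.dif_eq' j)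
    · intro p hp hp'
      rw [hf, dif_apply, ← hi, hper' i p hp, sub_self]
      rw [List.length_ofFn] at hp'
      push_cast
      rwa [Int.toNat_of_nonneg hs.le]
  refine periodic_of_sh_eq (t := (|g| * K) • w)
    (smul_ne_zero (mul_ne_zero (abs_ne_zero.2 hg) hK) hw) ?_
  ext p
  apply hφ
  have := congrFun hf0 p
  simp only [hf, dif_apply, Pi.zero_apply, sub_eq_zero] at this
  exact_mod_cast this

/-- Distinct configurations of `X` can agree on an open half plane bounded by a line along `w`. -/
def NondeterministicAlong (X : Set (ℤ × ℤ → A)) (w : ℤ × ℤ) : Prop :=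
  ∃ d ∈ X, ∃ e ∈ X, (∀ p, 0 < detForm w p → d p = e p) ∧ d ≠ e

variable [Finite A] [TopologicalSpace A] [DiscreteTopology A]

theorem nondeterministicAlong_and_stripPeriodicExtends {φ : A → ℤ} (hφ : Function.Injective φ)
    {X : Set (ℤ × ℤ → A)} (hX : IsClosed X) (hne : X.Nonempty)
    (hinv : ∀ t, ∀ d ∈ X, sh t d ∈ X) {w v : ℤ × ℤ} (hw : IsCoprime w.1 w.2) {g : ℤ}
    (hg : g ≠ 0) (hv : v = g • w) {m : ℕ} (hm : m ≠ 0) {B : ℝ} {V : Fin m → ℤ × ℤ}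
    (hV : ∀ j, detForm v (V j) ≠ 0) (hdec : ∀ d ∈ X, ∃ a b, Decomposes φ B v V d a b)
    (hmin : ∀ d ∈ X, ¬ IsSumOfPeriodic φ d m) :
    NondeterministicAlong X w ∧ StripPeriodicExtends X w := by
  obtain ⟨s, hs, c, c', hc⟩ := exists_common_transversal hw hg hv V hV
  have hw0 : w ≠ 0 := by
    rintro rfl
    exact not_isCoprime_zero_zero hw
  have hs0 : ∀ k : ℕ, 1 ≤ k → ∀ j : Fin m, (k : ℤ) • (s - c j • v) ≠ 0 := by
    intro k hk j h0
    have h1 : detForm w ((k : ℤ) • (s - c j • v)) = k * detForm w s := by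
      rw [map_zsmul, map_sub, hv, smul_smul, detForm_smul_self, sub_zero, smul_eq_mul]
    rw [h0, map_zero] at h1
    have : 0 < (k : ℤ) * detForm w s := by positivity
    linarith
  have hdec' : ∀ d ∈ X, ∃ a b, Decomposes φ B v (fun j => s - c j • v) d a b := by
    intro d hd
    obtain ⟨a, b, h⟩ := hdec d hd
    exact ⟨a, b, h.abs_le, h.abs_le', h.dif_eq, fun j => by
      rw [← (hc j).2]
      exact dif_zsmul_eq_zero (h.dif_eq' j) _, h.eq_sum⟩
  refine ⟨?_, stripPeriodicExtends_of_decomposes hφ hg hw0 hv hs (fun j => rfl) hdec'⟩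
  by_contra hdet
  have hdet' : ∀ d ∈ X, ∀ e ∈ X, (∀ p, 0 < detForm w p → d p = e p) → d = e := by
    intro d hd e he h
    by_contra hde
    exact hdet ⟨d, hd, e, he, h, hde⟩
  obtain ⟨d, hd, a, b, h, k, hk, hper⟩ := exists_periodic_component_of_deterministic (detForm w) hs
    (exists_strip_representatives hw hg hv) hφ hX hne hinv (fun j => rfl) hdec' hdet'
  obtain ⟨j₀⟩ : Nonempty (Fin m) := ⟨⟨0, Nat.pos_of_ne_zero hm⟩⟩
  refine hmin d hd (h.isSumOfPeriodic_of_absorb (fun j => ?_) j₀ (hs0 k hk j₀) ?_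
    (dif_zsmul_eq_zero (h.dif_eq' j₀) _))
  · simpa using hs0 1 le_rfl j
  · rw [smul_sub]
    refine dif_sub_eq_zero ?_ (dif_zsmul_eq_zero (dif_zsmul_eq_zero h.dif_eq _) _)
    ext p
    have := congrFun hper p
    rw [sh_apply] at this
    rw [dif_apply, natCast_zsmul, this, sub_self]
    rfl

theorem exists_periodic_or_nondeterministic {φ : A → ℤ} (hφ : Function.Injective φ)
    {X : Set (ℤ × ℤ → A)} (hX : IsClosed X) (hinv : ∀ t, ∀ d ∈ X, sh t d ∈ X)
    {c : ℤ × ℤ → A} (hc : c ∈ X) {n : ℕ} (hcn : IsSumOfPeriodic φ c n) :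
    (∃ d ∈ X, Periodic d) ∨ ∃ Y ⊆ X, IsClosed Y ∧ (∀ t, ∀ d ∈ Y, sh t d ∈ Y) ∧
      ∃ w : ℤ × ℤ, IsCoprime w.1 w.2 ∧ NondeterministicAlong Y w ∧ StripPeriodicExtends Y w ∧
        NondeterministicAlong Y (-w) ∧ StripPeriodicExtends Y (-w) := by
  classical
  have hex : ∃ n, ∃ d ∈ X, IsSumOfPeriodic φ d n := ⟨n, c, hc, hcn⟩
  obtain ⟨d, hd, V, hV, B, g, hgB, hgV, hsum⟩ := Nat.find_spec hex
  have hmin : ∀ m < Nat.find hex, ∀ d ∈ X, ¬ IsSumOfPeriodic φ d m := fun m hm d hd h =>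
    Nat.find_min hex hm ⟨d, hd, h⟩
  generalize Nat.find hex = N at *
  rcases N with _ | m
  · left
    refine ⟨d, hd, periodic_of_sh_eq (t := (1, 0)) (by simp) ?_⟩
    ext p
    apply hφ
    have h1 := hsum (p + (1, 0))
    have h2 := hsum p
    rw [Fin.sum_univ_zero, Int.cast_eq_zero] at h1 h2
    rw [sh_apply, h1, h2]
  rcases eq_or_ne m 0 with rfl | hm
  · left
    refine ⟨d, hd, periodic_of_sh_eq (hV 0) ?_⟩
    ext p
    apply hφ
    have h1 : (φ (d (p + V 0)) : ℝ) = g 0 (p + V 0) := (hsum _).trans (Fin.sum_univ_one _)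
    have h2 : (φ (d p) : ℝ) = g 0 p := (hsum p).trans (Fin.sum_univ_one _)
    have h3 := congrFun (hgV 0) p
    rw [dif_apply, Pi.zero_apply, sub_eq_zero, ← h1, ← h2] at h3
    rw [sh_apply]
    exact_mod_cast h3
  right
  have hdecd : Decomposes φ B (V 0) (fun j : Fin m => V j.succ) d (g 0) (fun j => g j.succ) :=
    ⟨hgB 0, fun j => hgB j.succ, hgV 0, fun j => hgV j.succ, fun p => by
      rw [hsum, Fin.sum_univ_succ]⟩
  set Ω := {x : (ℤ × ℤ → A) × (ℤ × ℤ → ℝ) × (Fin m → ℤ × ℤ → ℝ) |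
      x.1 ∈ X ∧ Decomposes φ B (V 0) (fun j : Fin m => V j.succ) x.1 x.2.1 x.2.2} with hΩdef
  have hΩ : IsCompact Ω := isCompact_setOf_decomposes φ B _ _ hX
  have hYX : Prod.fst '' Ω ⊆ X := by
    rintro _ ⟨x, hx, rfl⟩
    exact hx.1
  have hYinv : ∀ t, ∀ d ∈ Prod.fst '' Ω, sh t d ∈ Prod.fst '' Ω := by
    rintro t _ ⟨⟨d, a, b⟩, ⟨hd, h⟩, rfl⟩
    exact ⟨⟨sh t d, sh t a, fun j => sh t (b j)⟩, ⟨hinv t d hd, h.sh t⟩, rfl⟩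
  have hYc : IsClosed (Prod.fst '' Ω) := (hΩ.image continuous_fst).isClosed
  have hYne : (Prod.fst '' Ω).Nonempty := ⟨d, ⟨d, g 0, fun j => g j.succ⟩, ⟨hd, hdecd⟩, rfl⟩
  have hYdec : ∀ d ∈ Prod.fst '' Ω,
      ∃ a b, Decomposes φ B (V 0) (fun j : Fin m => V j.succ) d a b := by
    rintro _ ⟨⟨d, a, b⟩, ⟨hd, h⟩, rfl⟩
    exact ⟨a, b, h⟩
  have hYmin : ∀ d ∈ Prod.fst '' Ω, ¬ IsSumOfPeriodic φ d m := fun d hd =>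
    hmin m (Nat.lt_succ_self m) d (hYX hd)
  obtain ⟨w, hw, r, hr, hv⟩ := exists_eq_smul_isCoprime (hV 0)
  have hdet : ∀ j : Fin m, detForm (V 0) (V j.succ) ≠ 0 := by
    intro j h0
    have h1 : detForm w (V j.succ) = 0 := by
      have : r * detForm w (V j.succ) = 0 := by
        rw [← h0, hv]
        simp only [detForm_apply, Prod.smul_fst, Prod.smul_snd, smul_eq_mul]
        ring
      exact (mul_eq_zero.1 this).resolve_left hr
    obtain ⟨i, hi⟩ := exists_eq_smul_of_detForm_eq_zero hw h1
    have h2 : r • V j.succ = i • V 0 := by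
      rw [hi, hv, smul_smul, smul_smul, mul_comm]
    refine hmin m (Nat.lt_succ_self m) d hd (hdecd.isSumOfPeriodic_of_absorb (w := r • V j.succ)
      (fun j => hV j.succ) j (smul_ne_zero hr (hV _)) ?_ (dif_zsmul_eq_zero (hgV j.succ) _))
    rw [h2]
    exact dif_zsmul_eq_zero (hgV 0) _
  obtain ⟨h1, h2⟩ := nondeterministicAlong_and_stripPeriodicExtends hφ hYc hYne hYinv hw hr hv hm
    hdet hYdec hYmin
  obtain ⟨h3, h4⟩ := nondeterministicAlong_and_stripPeriodicExtends hφ hYc hYne hYinv (w := -w)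
    hw.neg_neg (neg_ne_zero.2 hr) (by rw [hv]; simp) hm hdet hYdec hYmin
  exact ⟨_, hYX, hYc, hYinv, w, hw, h1, h2, h3, h4⟩

end MinimalDecomposition

section PatternCounting

theorem Set.Finite.ncard_image_add_ncard_le {α β : Type*} {P Q : Set α} (hP : P.Finite)
    (hQ : Q ⊆ P) (r : α → β) : (r '' P).ncard + Q.ncard ≤ (r '' Q).ncard + P.ncard := by
  have h1 : (r '' P).ncard ≤ (r '' Q).ncard + (r '' (P \ Q)).ncard := by
    rw [← Set.union_sdiff_cancel hQ, Set.image_union, Set.union_sdiff_cancel hQ]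
    exact Set.ncard_union_le _ _
  have h2 := Set.ncard_image_le (f := r) (hP.subset (Set.sdiff_subset (t := Q)))
  have h3 := Set.ncard_sdiff_add_ncard_of_subset hQ hP
  omega

theorem Set.Finite.ncard_image_add_ncard_le_of_two_preimages {α β : Type*} {P : Set α}
    (hP : P.Finite) {r : α → β} {R : Set β}
    (hR : ∀ q ∈ R, ∃ x ∈ P, ∃ y ∈ P, x ≠ y ∧ r x = q ∧ r y = q) :
    (r '' P).ncard + R.ncard ≤ P.ncard := by
  obtain ⟨S, hSP, hS⟩ := (Set.surjOn_image r P).exists_bijOn_subset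
  have h1 : R ⊆ r '' (P \ S) := by
    intro q hq
    obtain ⟨x, hx, y, hy, hxy, hxq, hyq⟩ := hR q hq
    by_cases hxS : x ∈ S
    · exact ⟨y, ⟨hy, fun hyS => hxy (hS.injOn hxS hyS (hxq.trans hyq.symm))⟩, hyq⟩
    · exact ⟨x, ⟨hx, hxS⟩, hxq⟩
  have hfin : (P \ S).Finite := hP.subset Set.sdiff_subset
  have h2 := (Set.ncard_le_ncard h1 (hfin.image r)).trans (Set.ncard_image_le hfin)
  have h3 := Set.ncard_sdiff_add_ncard_of_subset hSP hP
  have h4 : (r '' P).ncard ≤ S.ncard := by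
    rw [← hS.image_eq]
    exact Set.ncard_image_le (hP.subset hSP)
  omega

variable {G A : Type*}

/-- The number of patterns of shape `T` shown at the origin by the configurations in `Z`. -/
noncomputable def npat (Z : Set (G → A)) (T : Finset G) : ℕ :=
  ((T.restrict : (G → A) → T → A) '' Z).ncard

theorem restrict_eq_restrict_iff {T : Finset G} {d e : G → A} :
    T.restrict d = T.restrict e ↔ ∀ p ∈ T, d p = e p := by
  simp [funext_iff]

theorem image_restrict₂_image_restrict {T T' : Finset G} (h : T ⊆ T') (Z : Set (G → A)) :
    Finset.restrict₂ (π := fun _ => A) h '' (T'.restrict '' Z) = T.restrict '' Z := by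
  rw [← Set.image_comp, Finset.restrict₂_comp_restrict]

theorem npat_pos [Finite A] {Z : Set (G → A)} (hZ : Z.Nonempty) (T : Finset G) : 0 < npat Z T :=
  (Set.ncard_pos (Set.toFinite _)).2 (hZ.image _)

theorem eqOn_of_npat_le [Finite A] {Z : Set (G → A)} {T T' : Finset G} (h : T ⊆ T')
    (hn : npat Z T' ≤ npat Z T) {d e : G → A} (hd : d ∈ Z) (he : e ∈ Z)
    (hde : ∀ p ∈ T, d p = e p) : ∀ p ∈ T', d p = e p := by
  rw [npat, npat, ← image_restrict₂_image_restrict h] at hn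
  have hinj := Set.injOn_of_ncard_image_eq (le_antisymm (Set.ncard_image_le (Set.toFinite _)) hn)
    (Set.toFinite _)
  refine restrict_eq_restrict_iff.1 (hinj ⟨d, hd, rfl⟩ ⟨e, he, rfl⟩ ?_)
  exact restrict_eq_restrict_iff.2 hde

theorem npat_add_npat_le [Finite A] {X Z : Set (G → A)} (hZ : Z ⊆ X) {T T' : Finset G}
    (h : T ⊆ T') : npat X T + npat Z T' ≤ npat Z T + npat X T' := by
  simp only [npat]
  rw [← image_restrict₂_image_restrict h, ← image_restrict₂_image_restrict h]
  exact (Set.toFinite _).ncard_image_add_ncard_le (Set.image_mono hZ) _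

theorem npat_add_npat_le_of_two_extensions [Finite A] {X Z : Set (G → A)} {T T' : Finset G}
    (h : T ⊆ T') (hZ : ∀ z ∈ Z, ∃ d ∈ X, ∃ e ∈ X, (∀ p ∈ T, d p = z p) ∧ (∀ p ∈ T, e p = z p) ∧
      ∃ p ∈ T', d p ≠ e p) : npat X T + npat Z T ≤ npat X T' := by
  simp only [npat]
  rw [← image_restrict₂_image_restrict h X]
  refine (Set.toFinite _).ncard_image_add_ncard_le_of_two_preimages ?_
  rintro _ ⟨z, hz, rfl⟩
  obtain ⟨d, hd, e, he, hdz, hez, p, hp, hne⟩ := hZ z hz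
  exact ⟨_, ⟨d, hd, rfl⟩, _, ⟨e, he, rfl⟩, fun h => hne (restrict_eq_restrict_iff.1 h p hp),
    restrict_eq_restrict_iff.2 hdz, restrict_eq_restrict_iff.2 hez⟩

end PatternCounting

section Propagation

theorem exists_period_of_propagates {S : Type*} [Finite S] {f : ℤ → S} {K : ℕ}
    (h : ∀ i j, (K : ℤ) ∣ i - j → f i = f j → f (i + 1) = f (j + 1)) :
    ∃ m : ℕ, 0 < m ∧ ∀ i, f (i + (m * K : ℕ)) = f i := by
  have hfwd : ∀ (n : ℕ) (i j : ℤ), (K : ℤ) ∣ i - j → f i = f j → f (i + n) = f (j + n) := by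
    intro n
    induction n with
    | zero => simp
    | succ n ih =>
      intro i j hij hf
      have := h _ _ (by simpa using hij) (ih i j hij hf)
      push_cast
      simpa only [add_assoc] using this
  have hback : ∀ i : ℤ, ∃ q : ℕ, 0 < q ∧ q ≤ Nat.card S ∧ f i = f (i - q * K) := by
    intro i
    obtain ⟨a, b, hf, hab⟩ := Function.not_injective_iff.1 fun hinj =>
      absurd (Nat.card_le_card_of_injective (fun a : Fin (Nat.card S + 1) => f (i - a * K)) hinj)
        (by simp)
    wlog hlt : a < b generalizing a b
    · exact this b a hf.symm hab.symm (lt_of_le_of_ne (not_lt.1 hlt) hab.symm)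
    have hlt' : (a : ℕ) < b := hlt
    refine ⟨b - a, by omega, by omega, ?_⟩
    have := hfwd (a * K) _ _ ⟨(b : ℤ) - a, by ring⟩ hf
    push_cast [hlt'.le] at this ⊢
    convert this using 2 <;> ring
  set M := (Nat.card S).factorial
  have key : ∀ i : ℤ, f (i - (M * K : ℕ)) = f i := by
    intro i
    obtain ⟨q, hq, hqN, hf⟩ := hback (i - M * K)
    obtain ⟨r, hr⟩ : q ∣ M := Nat.dvd_factorial hq hqN
    have hstep : ∀ k ≤ r, f (i - k * q * K) = f i := by
      intro k
      induction k with
      | zero => simp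
      | succ k ih =>
        intro hk
        rw [← ih (by omega)]
        have := hfwd ((r - k) * q * K) _ _ ⟨q, by ring⟩ hf
        rw [hr] at this
        push_cast [(Nat.le_of_succ_le hk)] at this ⊢
        convert this.symm using 2 <;> ring
    have := hstep r le_rfl
    rw [hr]
    push_cast
    convert this using 2
    ring
  refine ⟨M, Nat.factorial_pos _, fun i => ?_⟩
  rw [← key (i + (M * K : ℕ)), add_sub_cancel_right]

variable {G A : Type*} [AddCommGroup G]

/-- If on the line `t + ℤ w` the patterns of shape `T` of `d` have a unique extension to `T'`, and
the content of each point of `T + w` is either in `T'` or known to be `K`-periodic along `w`,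
then `d` is periodic along `w` on `T'`. -/
theorem exists_period_of_npat_le [Finite A] {d : G → A} {t w : G} {T T' : Finset G} (h : T ⊆ T')
    (hn : npat (Set.range fun i : ℤ => sh (t + i • w) d) T' ≤
      npat (Set.range fun i : ℤ => sh (t + i • w) d) T) {K : ℕ}
    (hT : ∀ p ∈ T, p + w ∈ T' ∨ ∀ i : ℤ, d (p + (t + (i + K) • w)) = d (p + (t + i • w))) :
    ∃ m : ℕ, 0 < m ∧ ∀ p ∈ T', ∀ i : ℤ,
      d (p + (t + (i + (m * K : ℕ)) • w)) = d (p + (t + i • w)) := by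
  have hext : ∀ i j : ℤ, T.restrict (sh (t + i • w) d) = T.restrict (sh (t + j • w) d) →
      ∀ p ∈ T', d (p + (t + i • w)) = d (p + (t + j • w)) := fun i j hij =>
    eqOn_of_npat_le h hn ⟨i, rfl⟩ ⟨j, rfl⟩ (restrict_eq_restrict_iff.1 hij)
  obtain ⟨m, hm, hper⟩ := exists_period_of_propagates (K := K)
    (f := fun i : ℤ => T.restrict (sh (t + i • w) d)) (by
      intro i j hij hf
      rw [restrict_eq_restrict_iff]
      intro p hp
      simp only [sh_apply]
      rcases hT p hp with hp' | hp'
      · have := hext i j hf _ hp'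
        simpa only [add_smul, one_smul, add_assoc, add_comm w, add_left_comm w] using this
      · have hmul : ∀ (n : ℕ) (i : ℤ), d (p + (t + (i + n * K) • w)) = d (p + (t + i • w)) := by
          intro n
          induction n with
          | zero => simp
          | succ n ih =>
            intro i
            rw [← ih i, ← hp' (i + n * K)]
            congr 4
            push_cast
            ring
        have hmul' : ∀ (n i : ℤ), d (p + (t + (i + n * K) • w)) = d (p + (t + i • w)) := by
          intro n i
          obtain ⟨n, rfl | rfl⟩ := n.eq_nat_or_neg
          · exact hmul n i
          · rw [← hmul n]
            congr 4
            ring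
        obtain ⟨q, hq⟩ := hij
        rw [← hmul' q (j + 1)]
        congr 4
        linarith)
  exact ⟨m, hm, fun p hp i => hext _ _ (hper i) p hp⟩

end Propagation

section DiscreteConvexSets

theorem detForm_eq_inner2 (w p : ℤ × ℤ) : detForm w p = inner2 p (-w.2, w.1) := by
  rw [detForm_apply, inner2]; ring

theorem DiscreteConvex.setOf_lex_lt {D : Set (ℤ × ℤ)} (hD : DiscreteConvex D) (u u' : ℤ × ℤ)
    (m m' : ℤ) : DiscreteConvex
      {p | p ∈ D ∧ (inner2 p u < m ∨ (inner2 p u = m ∧ inner2 p u' < m'))} := by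
  obtain ⟨C, hC, rfl⟩ := hD
  refine ⟨C ∩ {x | x.1 * u.1 + x.2 * u.2 < m ∨
    (x.1 * u.1 + x.2 * u.2 = m ∧ x.1 * u'.1 + x.2 * u'.2 < m')}, hC.inter ?_, ?_⟩
  · rintro ⟨x₁, x₂⟩ hx ⟨y₁, y₂⟩ hy a b ha hb hab
    simp only [Set.mem_ofPred_eq, Prod.smul_mk, Prod.mk_add_mk, smul_eq_mul] at hx hy ⊢
    rcases ha.eq_or_lt with rfl | ha
    · obtain rfl : b = 1 := by linarith
      simpa using hy
    rcases hb.eq_or_lt with rfl | hb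
    · obtain rfl : a = 1 := by linarith
      simpa using hx
    have hm : (m : ℝ) = a * m + b * m := by rw [← add_mul, hab, one_mul]
    have hm' : (m' : ℝ) = a * m' + b * m' := by rw [← add_mul, hab, one_mul]
    rcases hx with hx | ⟨hx, hx'⟩ <;> rcases hy with hy | ⟨hy, hy'⟩
    · left
      linarith [mul_lt_mul_of_pos_left hx ha, mul_lt_mul_of_pos_left hy hb]
    · left
      have : b * _ = b * _ := congrArg (b * ·) hy
      linarith [mul_lt_mul_of_pos_left hx ha]
    · left
      have : a * _ = a * _ := congrArg (a * ·) hx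
      linarith [mul_lt_mul_of_pos_left hy hb]
    · right
      have h1 : a * _ = a * _ := congrArg (a * ·) hx
      have h2 : b * _ = b * _ := congrArg (b * ·) hy
      exact ⟨by linarith, by
        linarith [mul_lt_mul_of_pos_left hx' ha, mul_lt_mul_of_pos_left hy' hb]⟩
  · ext p
    simp only [inner2, Set.mem_ofPred_eq, Set.mem_preimage, Set.mem_inter_iff]
    norm_cast

theorem DiscreteConvex.setOf_lt {D : Set (ℤ × ℤ)} (hD : DiscreteConvex D) (u : ℤ × ℤ) (m : ℤ) :
    DiscreteConvex {p | p ∈ D ∧ inner2 p u < m} := by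
  simpa [inner2] using hD.setOf_lex_lt u 0 m 0

variable {w z : ℤ × ℤ}

theorem eq_smul_add_smul_of_detForm_eq_one (hz : detForm w z = 1) (p : ℤ × ℤ) :
    p = detForm w p • z + detForm p z • w := by
  rw [detForm_apply] at hz
  refine Prod.ext ?_ ?_ <;>
    simp only [Prod.fst_add, Prod.snd_add, Prod.smul_fst, Prod.smul_snd, smul_eq_mul, detForm_apply]
  · linear_combination -p.1 * hz
  · linear_combination -p.2 * hz

theorem detForm_smul_add_smul (hz : detForm w z = 1) (i j : ℤ) :
    detForm w (i • z + j • w) = i := by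
  rw [map_add, detForm_smul_self, map_zsmul, hz]; simp

theorem detForm_smul_add_smul_left (hz : detForm w z = 1) (i j : ℤ) :
    detForm (i • z + j • w) z = j := by
  rw [detForm_apply] at hz ⊢
  simp only [Prod.fst_add, Prod.snd_add, Prod.smul_fst, Prod.smul_snd, smul_eq_mul]
  linear_combination j * hz

/-- The lattice point with coordinates `(h, i)` lies in a discretely convex set containing the
segments `{(m₀, j) | α ≤ j ≤ α + s}` and `{(m₁, j) | β ≤ j ≤ β + s}` if `(h, i)` lies on the segment
between the corresponding points at offset `θ`. -/
theorem DiscreteConvex.mem_of_segments {D : Set (ℤ × ℤ)} (hD : DiscreteConvex D)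
    {m₀ m₁ α β s h i : ℤ}
    (h1 : m₀ • z + α • w ∈ D) (h2 : m₀ • z + (α + s) • w ∈ D)
    (h3 : m₁ • z + β • w ∈ D) (h4 : m₁ • z + (β + s) • w ∈ D) {μ θ : ℝ}
    (hμ : 0 ≤ μ) (hμ' : μ ≤ 1) (hθ : 0 ≤ θ) (hθ' : θ ≤ 1)
    (hh : (h : ℝ) = (1 - μ) * m₀ + μ * m₁)
    (hi : (i : ℝ) = (1 - μ) * α + μ * β + θ * s) : h • z + i • w ∈ D := by
  obtain ⟨C, hC, rfl⟩ := hD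
  simp only [Set.mem_preimage] at *
  have ha := hC h1 h2 (sub_nonneg.2 hθ') hθ (sub_add_cancel _ _)
  have hb := hC h3 h4 (sub_nonneg.2 hθ') hθ (sub_add_cancel _ _)
  have hc := hC ha hb (sub_nonneg.2 hμ') hμ (sub_add_cancel _ _)
  convert hc using 1
  simp only [Prod.fst_add, Prod.snd_add, Prod.smul_fst, Prod.smul_snd, smul_eq_mul,
    Prod.smul_mk, Prod.mk_add_mk]
  push_cast
  rw [hh, hi]
  ext <;> dsimp only <;> ring

theorem DiscreteConvex.mem_of_row {D : Set (ℤ × ℤ)} (hD : DiscreteConvex D)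
    {h α β i : ℤ} (hα : h • z + α • w ∈ D) (hβ : h • z + β • w ∈ D) (h1 : α ≤ i) (h2 : i ≤ β) :
    h • z + i • w ∈ D := by
  rcases h1.eq_or_lt with rfl | h1
  · exact hα
  have h0 : (0 : ℝ) < β - α := by
    rw [sub_pos]
    exact_mod_cast h1.trans_le h2
  have h1' : (α : ℝ) < i := by exact_mod_cast h1
  have h2' : (i : ℝ) ≤ β := by exact_mod_cast h2
  have hβ' : h • z + (α + (β - α)) • w ∈ D := by rwa [add_sub_cancel]
  refine hD.mem_of_segments hα hβ' hα hβ' le_rfl zero_le_one (θ := (i - α) / (β - α))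
    (div_nonneg (by linarith) h0.le) ((div_le_one h0).2 (by linarith)) (by simp) ?_
  push_cast
  rw [div_mul_cancel₀ _ h0.ne']
  ring

/-- If the rows `m₀` and `m₁` of a discretely convex set contain `s + 1` consecutive points, then
each row between them contains `s` consecutive points. -/
theorem DiscreteConvex.exists_row_segment {D : Set (ℤ × ℤ)} (hD : DiscreteConvex D)
    {m₀ m₁ α β s h : ℤ}
    (h1 : m₀ • z + α • w ∈ D) (h2 : m₀ • z + (α + s) • w ∈ D)
    (h3 : m₁ • z + β • w ∈ D) (h4 : m₁ • z + (β + s) • w ∈ D) (hh : m₀ ≤ h) (hh' : h ≤ m₁) :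
    ∃ γ : ℤ, ∀ i : ℤ, 0 ≤ i → i < s → h • z + (γ + i) • w ∈ D := by
  rcases hh.eq_or_lt with rfl | hlt
  · exact ⟨α, fun i hi hi' => hD.mem_of_row h1 h2 (by omega) (by omega)⟩
  have h0 : (0 : ℝ) < m₁ - m₀ := by
    rw [sub_pos]
    exact_mod_cast hlt.trans_le hh'
  have hlt' : (m₀ : ℝ) < h := by exact_mod_cast hlt
  have hle' : (h : ℝ) ≤ m₁ := by exact_mod_cast hh'
  set μ : ℝ := (h - m₀) / (m₁ - m₀) with hμ
  set ρ : ℝ := (1 - μ) * α + μ * β with hρ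
  refine ⟨⌈ρ⌉, fun i hi hi' => ?_⟩
  have hs : (0 : ℝ) < s := by exact_mod_cast hi.trans_lt hi'
  have hi0 : (0 : ℝ) ≤ i := by exact_mod_cast hi
  have hi1 : (i : ℝ) + 1 ≤ s := by exact_mod_cast hi'
  refine hD.mem_of_segments h1 h2 h3 h4 (μ := μ) (θ := (⌈ρ⌉ + i - ρ) / s)
    (div_nonneg (by linarith) h0.le) ((div_le_one h0).2 (by linarith))
    (div_nonneg (by linarith [Int.le_ceil ρ]) hs.le)
    ((div_le_one hs).2 (by linarith [Int.ceil_lt_add_one ρ])) ?_ ?_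
  · rw [hμ]
    field_simp
    ring
  · rw [div_mul_cancel₀ _ hs.ne', ← hρ]
    push_cast
    ring

theorem DiscreteConvex.exists_row {D : Finset (ℤ × ℤ)} (hD : DiscreteConvex (D : Set (ℤ × ℤ)))
    (hz : detForm w z = 1) (h : ℤ) :
    ∃ (α : ℤ) (n : ℕ), (D.filter fun p => detForm w p = h).card = n ∧
      ∀ i, h • z + i • w ∈ D ↔ α ≤ i ∧ i < α + n := by
  set S := (D.filter fun p => detForm w p = h).image fun p => detForm p z with hS
  have hcard : S.card = (D.filter fun p => detForm w p = h).card := by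
    refine Finset.card_image_of_injOn fun p hp q hq hpq => ?_
    rw [eq_smul_add_smul_of_detForm_eq_one hz p, eq_smul_add_smul_of_detForm_eq_one hz q]
    simp only [Finset.coe_filter, Set.mem_ofPred_eq] at hp hq hpq
    rw [hp.2, hq.2, hpq]
  have hmem : ∀ i, i ∈ S ↔ h • z + i • w ∈ D := by
    intro i
    simp only [hS, Finset.mem_image, Finset.mem_filter]
    constructor
    · rintro ⟨p, ⟨hp, rfl⟩, rfl⟩
      rwa [← eq_smul_add_smul_of_detForm_eq_one hz p]
    · exact fun hi => ⟨_, ⟨hi, detForm_smul_add_smul hz _ _⟩, detForm_smul_add_smul_left hz _ _⟩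
  rcases S.eq_empty_or_nonempty with h0 | h0
  · refine ⟨0, 0, by rw [← hcard, h0, Finset.card_empty], fun i => ?_⟩
    rw [← hmem, h0]
    simp
  have hIcc : S = Finset.Icc (S.min' h0) (S.max' h0) := by
    ext i
    rw [Finset.mem_Icc]
    refine ⟨fun hi => ⟨S.min'_le _ hi, S.le_max' _ hi⟩, fun hi => (hmem i).2 ?_⟩
    exact hD.mem_of_row ((hmem _).1 (S.min'_mem h0)) ((hmem _).1 (S.max'_mem h0)) hi.1 hi.2
  have hle := S.min'_le_max' h0
  have hc : S.card = (S.max' h0 + 1 - S.min' h0).toNat := by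
    conv_lhs => rw [hIcc]
    exact Int.card_Icc _ _
  refine ⟨S.min' h0, S.card, hcard.symm, fun i => ?_⟩
  rw [← hmem, hc]
  conv_lhs => rw [hIcc]
  rw [Finset.mem_Icc]
  omega

end DiscreteConvexSets

section MinimalShape

variable {A : Type*}

theorem exists_le_succ_of_lt_add {g : ℕ → ℕ} {N : ℕ} (h : g 0 < g N + N) :
    ∃ j < N, g j ≤ g (j + 1) := by
  by_contra! hg
  have key : ∀ k ≤ N, g k + k ≤ g 0 := by
    intro k
    induction k with
    | zero => simp
    | succ k ih =>
      intro hk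
      have := ih (by omega)
      have := hg k (by omega)
      omega
  have := key N le_rfl
  omega

theorem exists_succ_le_of_lt_add {g : ℕ → ℕ} {N : ℕ} (h : g N < g 0 + N) :
    ∃ j < N, g (j + 1) ≤ g j := by
  by_contra! hg
  have key : ∀ k ≤ N, g 0 + k ≤ g k := by
    intro k
    induction k with
    | zero => simp
    | succ k ih =>
      intro hk
      have := ih (by omega)
      have := hg k (by omega)
      omega
  have := key N le_rfl
  omega

/-- `D` is a discretely convex set of low complexity in `X`, and no proper subset of it is. -/
structure IsMinimalShape (X : Set (ℤ × ℤ → A)) (D : Finset (ℤ × ℤ)) : Prop where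
  convex : DiscreteConvex (D : Set (ℤ × ℤ))
  npat_le : npat X D ≤ D.card
  card_lt : ∀ D' ⊂ D, DiscreteConvex (D' : Set (ℤ × ℤ)) → D'.card < npat X D'

theorem exists_isMinimalShape {X : Set (ℤ × ℤ → A)} {D : Finset (ℤ × ℤ)}
    (hD : DiscreteConvex (D : Set (ℤ × ℤ))) (h : npat X D ≤ D.card) :
    ∃ D', IsMinimalShape X D' := by
  induction D using Finset.strongInduction with
  | H D ih =>
    by_cases hD' : ∃ D' ⊂ D, DiscreteConvex (D' : Set (ℤ × ℤ)) ∧ npat X D' ≤ D'.card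
    · obtain ⟨D', hlt, hc, hn⟩ := hD'
      exact ih D' hlt hc hn
    · push Not at hD'
      exact ⟨D, hD, h, hD'⟩

namespace IsMinimalShape

variable {X : Set (ℤ × ℤ → A)} {D : Finset (ℤ × ℤ)} {w z : ℤ × ℤ}

theorem npat_lt_of_lt (h : IsMinimalShape X D) {w : ℤ × ℤ} {m : ℤ} (hm : ∀ p ∈ D, detForm w p ≤ m)
    (hne : 0 < (D.filter fun p => detForm w p = m).card) :
    npat X D < npat X (D.filter fun p => detForm w p < m) +
      (D.filter fun p => detForm w p = m).card := by
  have hc := Finset.card_filter_add_card_filter_not (s := D) fun p => detForm w p < m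
  have hf : (D.filter fun p => ¬ detForm w p < m) = D.filter fun p => detForm w p = m :=
    Finset.filter_congr fun p hp => by have := hm p hp; omega
  rw [hf] at hc
  have hconv : DiscreteConvex ((D.filter fun p => detForm w p < m : Finset (ℤ × ℤ)) :
      Set (ℤ × ℤ)) := by
    convert h.convex.setOf_lt (-w.2, w.1) m using 1
    ext p
    simp [detForm_eq_inner2]
  have := h.card_lt _ (Finset.filter_ssubset.2 (by
    obtain ⟨p, hp⟩ := Finset.card_pos.1 hne
    rw [Finset.mem_filter] at hp
    exact ⟨p, hp.1, by omega⟩)) hconv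
  have := h.npat_le
  omega

theorem npat_lt_of_gt (h : IsMinimalShape X D) {m : ℤ} (hm : ∀ p ∈ D, m ≤ detForm w p)
    (hne : 0 < (D.filter fun p => detForm w p = m).card) :
    npat X D < npat X (D.filter fun p => m < detForm w p) +
      (D.filter fun p => detForm w p = m).card := by
  have := h.npat_lt_of_lt (w := -w) (m := -m) (fun p hp => by
    rw [detForm_neg]
    exact neg_le_neg (hm p hp))
  simp only [detForm_neg, neg_inj, neg_lt_neg_iff] at this
  exact this hne

/-- An extreme point of the bottom row is determined by the rest of `D`. -/
theorem npat_le_erase (h : IsMinimalShape X D) {m : ℤ} (hm : ∀ p ∈ D, m ≤ detForm w p)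
    {x : ℤ × ℤ} (hx : x ∈ D) (hxm : detForm w x = m) {u : ℤ × ℤ}
    (hu : ∀ p ∈ D, detForm w p = m → p ≠ x → inner2 p u < inner2 x u) :
    npat X D ≤ npat X (D.erase x) := by
  have hconv : DiscreteConvex ((D.erase x : Finset (ℤ × ℤ)) : Set (ℤ × ℤ)) := by
    convert h.convex.setOf_lex_lt (w.2, -w.1) u (-m) (inner2 x u) using 1
    ext p
    have hp : inner2 p (w.2, -w.1) = -detForm w p := by rw [detForm_apply, inner2]; ring
    simp only [Finset.coe_erase, Set.mem_sdiff, Set.mem_singleton_iff, Set.mem_ofPred_eq,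
      Finset.mem_coe, hp, neg_lt_neg_iff, neg_inj]
    constructor
    · rintro ⟨hpD, hpx⟩
      refine ⟨hpD, ?_⟩
      rcases (hm p hpD).lt_or_eq with h1 | h1
      · exact .inl h1
      · exact .inr ⟨h1.symm, hu p hpD h1.symm hpx⟩
    · rintro ⟨hpD, hp⟩
      refine ⟨hpD, ?_⟩
      rintro rfl
      omega
  have h1 := h.card_lt _ (Finset.erase_ssubset hx) hconv
  have h2 := Finset.card_erase_add_one hx
  have h3 := h.npat_le
  omega

end IsMinimalShape

end MinimalShape

section StripPeriodicity

variable {A : Type*} [Finite A] {X : Set (ℤ × ℤ → A)} {D : Finset (ℤ × ℤ)} {w z : ℤ × ℤ}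

/-- Two configurations that differ on the row of height `h₀` and agree above it differ on every
translate of `D` whose bottom row lies on that row. -/
theorem IsMinimalShape.exists_ne (hD : IsMinimalShape X D) (hinv : ∀ t, ∀ d ∈ X, sh t d ∈ X)
    (hz : detForm w z = 1) {m₀ α : ℤ} {n : ℕ} (hn : 0 < n) (hm₀ : ∀ p ∈ D, m₀ ≤ detForm w p)
    (hrow : ∀ i, m₀ • z + i • w ∈ D ↔ α ≤ i ∧ i < α + n) {d e : ℤ × ℤ → A} (hd : d ∈ X)
    (he : e ∈ X) {h₀ : ℤ} (hde : ∀ p, h₀ < detForm w p → d p = e p) {q : ℤ × ℤ}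
    (hq : detForm w q = h₀) (hdq : d q ≠ e q) (i : ℤ) :
    ∃ p ∈ D, d (p + ((h₀ - m₀) • z + i • w)) ≠ e (p + ((h₀ - m₀) • z + i • w)) := by
  have hκ : ∀ p, inner2 p (z.2, -z.1) = detForm p z := fun p => by
    rw [detForm_apply, inner2]; ring
  have hκ' : ∀ p, inner2 p (-z.2, z.1) = -detForm p z := fun p => by
    rw [detForm_apply, inner2]; ring
  have hcoord : ∀ p ∈ D, detForm w p = m₀ →
      ∃ j, p = m₀ • z + j • w ∧ α ≤ j ∧ j < α + n := by
    intro p hp hpm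
    have := eq_smul_add_smul_of_detForm_eq_one hz p
    rw [hpm] at this
    exact ⟨_, this, (hrow _).1 (this ▸ hp)⟩
  have hη : ∀ (p : ℤ × ℤ) (i : ℤ),
      detForm w (p + ((h₀ - m₀) • z + i • w)) = detForm w p + (h₀ - m₀) := fun p i => by
    rw [map_add, detForm_smul_add_smul hz]
  have hspread : ∀ (x : ℤ) (i i' : ℤ), α ≤ x → x < α + n → npat X D ≤ npat X (D.erase
        (m₀ • z + x • w)) →
      (∀ j, α ≤ j → j < α + n → j ≠ x → α ≤ j + i' - i ∧ j + i' - i < α + n) →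
      (∀ p ∈ D, d (p + ((h₀ - m₀) • z + i • w)) = e (p + ((h₀ - m₀) • z + i • w))) →
      ∀ p ∈ D, d (p + ((h₀ - m₀) • z + i' • w)) = e (p + ((h₀ - m₀) • z + i' • w)) := by
    intro x i i' hx hx' hle hshift hi
    refine eqOn_of_npat_le (Finset.erase_subset _ _) hle (hinv ((h₀ - m₀) • z + i' • w) d hd)
      (hinv ((h₀ - m₀) • z + i' • w) e he) fun p hp => ?_
    rw [Finset.mem_erase] at hp
    rcases (hm₀ p hp.2).lt_or_eq with h1 | h1
    · exact hde _ (by rw [hη]; omega)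
    · obtain ⟨j, rfl, hj⟩ := hcoord p hp.2 h1.symm
      have := hi _ ((hrow _).2 (hshift j hj.1 hj.2 (by rintro rfl; exact hp.1 rfl)))
      convert this using 2 <;> module
  by_contra! hi
  have hall : ∀ j : ℤ, ∀ p ∈ D,
      d (p + ((h₀ - m₀) • z + j • w)) = e (p + ((h₀ - m₀) • z + j • w)) := by
    intro j
    induction j using Int.inductionOn' (b := i) with
    | zero => exact hi
    | succ k _ ih =>
      refine hspread (α + n - 1) k _ (by omega) (by omega) ?_ (fun j h1 h2 h3 => by omega) ih
      refine hD.npat_le_erase (u := (z.2, -z.1)) hm₀ ((hrow _).2 (by omega))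
        (detForm_smul_add_smul hz _ _) fun p hp hpm hpx => ?_
      obtain ⟨j, rfl, hj⟩ := hcoord p hp hpm
      rw [hκ, hκ, detForm_smul_add_smul_left hz, detForm_smul_add_smul_left hz]
      have : j ≠ α + n - 1 := by rintro rfl; exact hpx rfl
      omega
    | pred k _ ih =>
      refine hspread α k _ (by omega) (by omega) ?_ (fun j h1 h2 h3 => by omega) ih
      refine hD.npat_le_erase (u := (-z.2, z.1)) hm₀ ((hrow _).2 (by omega))
        (detForm_smul_add_smul hz _ _) fun p hp hpm hpx => ?_
      obtain ⟨j, rfl, hj⟩ := hcoord p hp hpm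
      rw [hκ', hκ', detForm_smul_add_smul_left hz, detForm_smul_add_smul_left hz]
      have : j ≠ α := by rintro rfl; exact hpx rfl
      omega
  apply hdq
  have := hall (detForm q z - α) (m₀ • z + α • w) ((hrow _).2 (by omega))
  have hq' : q = m₀ • z + α • w + ((h₀ - m₀) • z + (detForm q z - α) • w) := by
    conv_lhs => rw [eq_smul_add_smul_of_detForm_eq_one hz q, hq]
    module
  rwa [← hq'] at this

/-- The strip just above the topmost disagreement of two configurations is periodic. -/
theorem IsMinimalShape.exists_periodic_strip (hD : IsMinimalShape X D)
    (hinv : ∀ t, ∀ d ∈ X, sh t d ∈ X) (hz : detForm w z = 1) {m₀ m₁ α β : ℤ} {n n' : ℕ}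
    (hn : 0 < n) (hnn' : n ≤ n') (hm₀ : ∀ p ∈ D, m₀ ≤ detForm w p)
    (hcard : (D.filter fun p => detForm w p = m₀).card = n)
    (hrow : ∀ i, m₀ • z + i • w ∈ D ↔ α ≤ i ∧ i < α + n)
    (hrow' : ∀ i, m₁ • z + i • w ∈ D ↔ β ≤ i ∧ i < β + n') {d e : ℤ × ℤ → A} (hd : d ∈ X)
    (he : e ∈ X) {h₀ : ℤ} (hde : ∀ p, h₀ < detForm w p → d p = e p) {q : ℤ × ℤ}
    (hq : detForm w q = h₀) (hdq : d q ≠ e q) :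
    ∃ K : ℕ, 0 < K ∧ ∀ p, h₀ < detForm w p → detForm w p ≤ h₀ + (m₁ - m₀) →
      d (p + (K : ℤ) • w) = d p := by
  set B := D.filter fun p => m₀ < detForm w p with hB
  set t := (h₀ - m₀) • z with ht
  set Z := Set.range fun i : ℤ => sh (t + i • w) d with hZ
  have hη : ∀ (p : ℤ × ℤ) (i : ℤ), detForm w (p + (t + i • w)) = detForm w p + (h₀ - m₀) :=
    fun p i => by rw [map_add, detForm_smul_add_smul hz]
  have hlt : npat X D < npat X B + n := by
    have := hD.npat_lt_of_gt hm₀ (by omega)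
    rwa [hcard] at this
  have hZB : npat X B + npat Z B ≤ npat X D := by
    refine npat_add_npat_le_of_two_extensions (Finset.filter_subset _ _) ?_
    rintro _ ⟨i, rfl⟩
    refine ⟨_, hinv _ d hd, _, hinv (t + i • w) e he, fun p _ => rfl, fun p hp => ?_,
      hD.exists_ne hinv hz hn hm₀ hrow hd he hde hq hdq i⟩
    exact (hde _ (by rw [hη]; have := (Finset.mem_filter.1 hp).2; omega)).symm
  let T : ℕ → Finset (ℤ × ℤ) := fun j => B.filter fun p => ∀ i : ℕ, i ≤ j → p + (i : ℤ) • w ∈ B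
  have hT0 : T 0 = B := Finset.filter_true_of_mem fun p hp i hi => by
    obtain rfl : i = 0 := by omega
    simpa using hp
  have hpos := npat_pos (Z := Z) (Set.range_nonempty _) (T (n - 1))
  obtain ⟨j, hj, hle⟩ := exists_le_succ_of_lt_add (g := fun j => npat Z (T j)) (N := n - 1) (by
    simp only [hT0]
    omega)
  have hsub : T (j + 1) ⊆ T j := Finset.monotone_filter_right _ fun p _ hp i hi => hp i (by omega)
  obtain ⟨m, hm, hper⟩ := exists_period_of_npat_le hsub hle (K := 1) fun p hp => by
    left
    have hp' := (Finset.mem_filter.1 hp).2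
    refine Finset.mem_filter.2 ⟨by simpa using hp' 1 (by omega), fun i hi => ?_⟩
    have := hp' (i + 1) (by omega)
    push_cast at this
    rwa [add_smul, one_smul, add_comm _ w, ← add_assoc] at this
  refine ⟨m, hm, fun p hp hp' => ?_⟩
  obtain ⟨γ, hγ⟩ := hD.convex.exists_row_segment (z := z) (w := w) (m₀ := m₀) (m₁ := m₁) (α := α)
    (β := β) (s := n - 1) (h := detForm w p - (h₀ - m₀)) ((hrow _).2 (by omega))
    ((hrow _).2 (by omega)) ((hrow' _).2 (by omega)) ((hrow' _).2 (by omega)) (by omega) (by omega)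
  have hmem : (detForm w p - (h₀ - m₀)) • z + γ • w ∈ T j := by
    have hγB : ∀ i : ℕ, i ≤ j → (detForm w p - (h₀ - m₀)) • z + γ • w + (i : ℤ) • w ∈ B := by
      intro i hi
      rw [add_assoc, ← add_smul]
      exact Finset.mem_filter.2 ⟨hγ i (by omega) (by omega), by
        rw [detForm_smul_add_smul hz]; omega⟩
    exact Finset.mem_filter.2 ⟨by simpa using hγB 0 (by omega), hγB⟩
  have := hper _ hmem (detForm p z - γ)
  convert this using 2
  · conv_lhs => rw [eq_smul_add_smul_of_detForm_eq_one hz p]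
    rw [ht]
    push_cast
    module
  · conv_lhs => rw [eq_smul_add_smul_of_detForm_eq_one hz p]
    rw [ht]
    module

/-- A periodic strip at least as high as `D` extends by one row. -/
theorem IsMinimalShape.exists_periodic_strip_succ (hD : IsMinimalShape X D)
    (hinv : ∀ t, ∀ d ∈ X, sh t d ∈ X) (hz : detForm w z = 1) {m₀ m₁ β : ℤ} {n' : ℕ}
    (hn' : 0 < n') (hm₀ : ∀ p ∈ D, m₀ ≤ detForm w p) (hm₁ : ∀ p ∈ D, detForm w p ≤ m₁)
    (hcard : (D.filter fun p => detForm w p = m₁).card = n')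
    (hrow : ∀ i, m₁ • z + i • w ∈ D ↔ β ≤ i ∧ i < β + n') {d : ℤ × ℤ → A} (hd : d ∈ X)
    {h₀ h₁ : ℤ} (hh : h₀ + (m₁ - m₀) ≤ h₁) {K : ℕ} (hK : 0 < K)
    (hper : ∀ p, h₀ < detForm w p → detForm w p ≤ h₁ → d (p + (K : ℤ) • w) = d p) :
    ∃ K : ℕ, 0 < K ∧ ∀ p, h₀ < detForm w p → detForm w p ≤ h₁ + 1 →
      d (p + (K : ℤ) • w) = d p := by
  set t := (h₁ + 1 - m₁) • z with ht
  set Z := Set.range fun i : ℤ => sh (t + i • w) d with hZ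
  have hη : ∀ (p : ℤ × ℤ) (i : ℤ), detForm w (p + (t + i • w)) = detForm w p + (h₁ + 1 - m₁) :=
    fun p i => by rw [map_add, detForm_smul_add_smul hz]
  let T : ℕ → Finset (ℤ × ℤ) := fun j =>
    D.filter fun p => detForm w p < m₁ ∨ detForm p z < β + j
  have hcoord : ∀ p ∈ D, ¬ detForm w p < m₁ → p = m₁ • z + detForm p z • w := by
    intro p hp hpm
    have h1 : detForm w p = m₁ := le_antisymm (hm₁ p hp) (not_lt.1 hpm)
    rw [← h1]
    exact eq_smul_add_smul_of_detForm_eq_one hz p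
  have hbound : ∀ p ∈ D, ¬ detForm w p < m₁ → β ≤ detForm p z ∧ detForm p z < β + n' :=
    fun p hp hpm => (hrow _).1 (hcoord p hp hpm ▸ hp)
  have hT0 : T 0 = D.filter fun p => detForm w p < m₁ := Finset.filter_congr fun p hp => by
    have := hbound p hp
    push_cast
    omega
  have hTn : T n' = D := Finset.filter_true_of_mem fun p hp => by
    have := hbound p hp
    omega
  have hlt := hD.npat_lt_of_lt hm₁ (by omega)
  rw [hcard] at hlt
  have hZX : Z ⊆ X := by
    rintro _ ⟨i, rfl⟩
    exact hinv _ d hd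
  have hle := npat_add_npat_le hZX (D.filter_subset fun p => detForm w p < m₁)
  obtain ⟨j, hj, hle'⟩ := exists_succ_le_of_lt_add (g := fun j => npat Z (T j)) (N := n') (by
    simp only [hT0, hTn]
    omega)
  have hsub : T j ⊆ T (j + 1) := Finset.monotone_filter_right _ fun p _ hp => by
    push_cast
    omega
  obtain ⟨m, hm, hper'⟩ := exists_period_of_npat_le hsub hle' (K := K) fun p hp => by
    obtain ⟨hpD, hp'⟩ := Finset.mem_filter.1 hp
    by_cases hpm : detForm w p < m₁
    · right
      intro i
      rw [← hper (p + (t + i • w)) (by rw [hη]; have := hm₀ p hpD; omega) (by rw [hη]; omega)]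
      congr 1
      module
    · left
      have h1 : p + w = m₁ • z + (detForm p z + 1) • w := by
        rw [add_smul, one_smul, ← add_assoc, ← hcoord p hpD hpm]
      have h2 := hbound p hpD hpm
      refine Finset.mem_filter.2 ⟨?_, .inr ?_⟩
      · rw [h1]
        exact (hrow _).2 (by omega)
      · rw [h1, detForm_smul_add_smul_left hz]
        push_cast
        omega
  refine ⟨m * K, Nat.mul_pos hm hK, fun p hp hp' => ?_⟩
  rcases hp'.lt_or_eq with h1 | h1
  · have : ∀ k : ℕ, d (p + ((k * K : ℕ) : ℤ) • w) = d p := by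
      intro k
      induction k with
      | zero => simp
      | succ k ih =>
        have hk : detForm w (p + ((k * K : ℕ) : ℤ) • w) = detForm w p := by
          rw [map_add, detForm_smul_self, add_zero]
        rw [← ih, ← hper (p + ((k * K : ℕ) : ℤ) • w) (by omega) (by omega)]
        congr 1
        push_cast
        module
    exact this m
  · have hmem : m₁ • z + β • w ∈ T (j + 1) := Finset.mem_filter.2
      ⟨(hrow _).2 (by omega), .inr (by rw [detForm_smul_add_smul_left hz]; push_cast; omega)⟩
    have := hper' _ hmem (detForm p z - β)
    convert this using 2
    · conv_lhs => rw [eq_smul_add_smul_of_detForm_eq_one hz p, h1]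
      rw [ht]
      module
    · conv_lhs => rw [eq_smul_add_smul_of_detForm_eq_one hz p, h1]
      rw [ht]
      module

theorem IsMinimalShape.exists_periodic (hD : IsMinimalShape X D)
    (hinv : ∀ t, ∀ d ∈ X, sh t d ∈ X) (hw : IsCoprime w.1 w.2) {m₀ m₁ : ℤ}
    (hm₀ : ∀ p ∈ D, m₀ ≤ detForm w p) (hm₁ : ∀ p ∈ D, detForm w p ≤ m₁)
    (hpos : 0 < (D.filter fun p => detForm w p = m₀).card)
    (hcard : (D.filter fun p => detForm w p = m₀).card ≤
      (D.filter fun p => detForm w p = m₁).card)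
    {Y : Set (ℤ × ℤ → A)} (hYX : Y ⊆ X) (hnd : NondeterministicAlong Y w)
    (hext : StripPeriodicExtends Y w) : ∃ d ∈ Y, Periodic d := by
  obtain ⟨z, hz⟩ := exists_detForm_eq_one hw
  obtain ⟨α, n, hn, hrow⟩ := hD.convex.exists_row hz m₀
  obtain ⟨β, n', hn', hrow'⟩ := hD.convex.exists_row hz m₁
  obtain ⟨d, hd, e, he, hde, hne⟩ := hnd
  obtain ⟨L, hL⟩ := hext
  obtain ⟨x, hx⟩ := Function.ne_iff.1 hne
  obtain ⟨h₀, ⟨q, hq, hdq⟩, hmax⟩ := Int.exists_greatest_of_bdd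
    (P := fun h => ∃ q, detForm w q = h ∧ d q ≠ e q)
    ⟨0, fun h ⟨q, hq, hdq⟩ => not_lt.1 fun h1 => hdq (hde q (hq ▸ h1))⟩ ⟨_, x, rfl, hx⟩
  have hde' : ∀ p, h₀ < detForm w p → d p = e p := fun p hp => by
    by_contra h
    exact absurd (hmax _ ⟨p, rfl, h⟩) (by omega)
  have hstrip : ∀ k : ℕ, ∃ K : ℕ, 0 < K ∧ ∀ p, h₀ < detForm w p →
      detForm w p ≤ h₀ + (m₁ - m₀) + k → d (p + (K : ℤ) • w) = d p := by
    intro k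
    induction k with
    | zero =>
      simpa using hD.exists_periodic_strip hinv hz (by omega) (by omega) hm₀ hn hrow hrow'
        (hYX hd) (hYX he) hde' hq hdq
    | succ k ih =>
      obtain ⟨K, hK, hper⟩ := ih
      have := hD.exists_periodic_strip_succ hinv hz (by omega) hm₀ hm₁ hn' hrow' (hYX hd)
        (by omega) hK hper
      simpa [add_assoc] using this
  obtain ⟨K, hK, hper⟩ := hstrip L
  have hle : m₀ ≤ m₁ := by
    obtain ⟨p, hp⟩ := Finset.card_pos.1 hpos
    have := hm₁ p (Finset.mem_filter.1 hp).1
    have := (Finset.mem_filter.1 hp).2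
    omega
  exact ⟨d, hd, hL d hd K (by omega) h₀ fun p h1 h2 => hper p h1 (by omega)⟩

end StripPeriodicity

section OrbitClosure

variable {A : Type*} [TopologicalSpace A]

theorem sh_mem_orbitClosure {c d : ℤ × ℤ → A} (hd : d ∈ orbitClosure c) (t : ℤ × ℤ) :
    sh t d ∈ orbitClosure c := by
  refine map_mem_closure (continuous_sh t) hd ?_
  rintro _ ⟨s, rfl⟩
  refine ⟨s - t, ?_⟩
  ext p
  simp only [sh_apply, Translate]
  congr 1
  abel

theorem self_mem_orbitClosure (c : ℤ × ℤ → A) : c ∈ orbitClosure c :=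
  subset_closure ⟨0, by ext p; simp [Translate]⟩

theorem npat_orbitClosure_le [Finite A] [DiscreteTopology A] (c : ℤ × ℤ → A) (D : Finset (ℤ × ℤ)) :
    npat (orbitClosure c) D ≤ (patterns c (D : Set (ℤ × ℤ))).ncard := by
  refine (Set.ncard_le_ncard ?_ (Set.toFinite _)).trans
    (Set.ncard_image_le (f := fun q (x : D) => q ⟨x, x.2⟩) (Set.toFinite _))
  rintro _ ⟨d, hd, rfl⟩
  have hopen : IsOpen ((D : Set (ℤ × ℤ)).pi fun p => {d p}) :=
    isOpen_set_pi D.finite_toSet fun _ _ => isOpen_discrete _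
  obtain ⟨_, hmem, s, rfl⟩ := mem_closure_iff.1 hd _ hopen fun p _ => rfl
  exact ⟨fun x => Translate s c x, ⟨s, fun x => rfl⟩, restrict_eq_restrict_iff.2 hmem⟩

end OrbitClosure

theorem IsMinimalShape.exists_extreme {A : Type*} {X : Set (ℤ × ℤ → A)} [Finite A]
    {D : Finset (ℤ × ℤ)} (hD : IsMinimalShape X D) (hX : X.Nonempty) (w : ℤ × ℤ) :
    ∃ m, (∀ p ∈ D, m ≤ detForm w p) ∧ 0 < (D.filter fun p => detForm w p = m).card := by
  have hne : D.Nonempty := Finset.card_pos.1 ((npat_pos hX D).trans_le hD.npat_le)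
  obtain ⟨p, hp, hmin⟩ := D.exists_min_image (detForm w) hne
  exact ⟨_, hmin, Finset.card_pos.2 ⟨p, Finset.mem_filter.2 ⟨hp, rfl⟩⟩⟩

/-- If a configuration over a finite alphabet has low complexity
with respect to a finite non-empty convex set `D ⊆ ℤ²`, then its orbit closure
contains a periodic configuration. -/
theorem orbitClosure_contains_periodic_of_low_complexity_convex
    {A : Type*} [Fintype A] [TopologicalSpace A] [DiscreteTopology A]
    (c : ℤ × ℤ → A) (D : Set (ℤ × ℤ))
    (hfin : D.Finite) (hne : D.Nonempty) (hconv : DiscreteConvex D)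
    (hlc : (patterns c D).ncard ≤ D.ncard) :
    ∃ c' ∈ orbitClosure c, Periodic c' := by
  lift D to Finset (ℤ × ℤ) using hfin
  have hc := self_mem_orbitClosure c
  have hinv : ∀ t, ∀ d ∈ orbitClosure c, sh t d ∈ orbitClosure c :=
    fun t d hd => sh_mem_orbitClosure hd t
  let φ : A → ℤ := fun a => (Fintype.equivFin A a : ℕ)
  have hφ : Function.Injective φ := fun a b hab =>
    (Fintype.equivFin A).injective (Fin.ext (Int.natCast_inj.1 hab))
  obtain ⟨V, hV, hVc⟩ := exists_difs_eq_zero_of_low_complexity φ c D D.finite_toSet hlc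
  rcases exists_periodic_or_nondeterministic hφ isClosed_closure hinv hc
    (isSumOfPeriodic_of_difs_eq_zero hV hVc) with h | ⟨Y, hYX, -, -, w, hw, h1, h2, h3, h4⟩
  · exact h
  obtain ⟨S, hS⟩ := exists_isMinimalShape hconv
    ((npat_orbitClosure_le c D).trans (hlc.trans_eq (Set.ncard_coe_finset D)))
  obtain ⟨m₀, hm₀, hpos₀⟩ := hS.exists_extreme ⟨c, hc⟩ w
  obtain ⟨m₁, hm₁, hpos₁⟩ := hS.exists_extreme ⟨c, hc⟩ (-w)
  have hneg : ∀ m, (S.filter fun p => detForm (-w) p = -m) = S.filter fun p => detForm w p = m :=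
    fun m => by simp [detForm_neg]
  have hneg' : ∀ m, (S.filter fun p => detForm (-w) p = m) = S.filter fun p => detForm w p = -m :=
    fun m => by simp [detForm_neg, neg_eq_iff_eq_neg]
  have hm₁' : ∀ p ∈ S, detForm w p ≤ -m₁ := fun p hp => by
    have := hm₁ p hp
    rw [detForm_neg] at this
    omega
  have hm₀' : ∀ p ∈ S, detForm (-w) p ≤ -m₀ := fun p hp => by
    have := hm₀ p hp
    rw [detForm_neg]
    omega
  rcases le_total (S.filter fun p => detForm w p = m₀).card
    (S.filter fun p => detForm w p = -m₁).card with hle | hle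
  · obtain ⟨d, hd, hper⟩ := hS.exists_periodic hinv hw hm₀ hm₁' hpos₀ hle hYX h1 h2
    exact ⟨d, hYX hd, hper⟩
  · obtain ⟨d, hd, hper⟩ := hS.exists_periodic hinv hw.neg_neg hm₁ hm₀' hpos₁
      (by rwa [hneg, hneg']) hYX h3 h4
    exact ⟨d, hYX hd, hper⟩
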